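/- arXiv:1208.6507 — 2 statements merged into one kernel-verified Lean document; each statement's English description precedes it below -/
import Mathlib

section
/- (Urysohn's inequality; solution of the Urysohn problem) Let K be a convex body in ℝ^n and let M(K) := (∫_{S^{n-1}} h_K dσ) / σ(S^{n-1}) be the average of its support function over the unit sphere, where σ is the (n−1)-dimensional Hausdorff measure restricted to S^{n-1}. Then vol(K) ≤ M(K)^n · vol(B), where vol is Lebesgue measure and B is the closed unit ball of ℝ^n. Consequently, among all convex bodies of fixed integral breadth, the ball has the greatest volume. -/
open MeasureTheory RealInnerProductSpace

/-- The support function of a set `K ⊆ ℝⁿ`. -/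
noncomputable def suppFn {n : ℕ} (K : Set (EuclideanSpace ℝ (Fin n)))
    (u : EuclideanSpace ℝ (Fin n)) : ℝ :=
  sSup ((fun x => ⟪x, u⟫) '' K)


open scoped Pointwise in
lemma bm_one_compact {A B C : Set ℝ} (hA : IsCompact A) (hB : IsCompact B)
    (hA0 : A.Nonempty) (hB0 : B.Nonempty) (hC : A + B ⊆ C) :
    volume A + volume B ≤ volume C := by
  obtain ⟨p, hp, hpm⟩ := hA.exists_isGreatest hA0
  obtain ⟨q, hq, hqm⟩ := hB.exists_isLeast hB0
  have h1 : volume (q +ᵥ A) = volume A := measure_vadd volume q A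
  have h2 : volume (p +ᵥ B) = volume B := measure_vadd volume p B
  rw [← h1, ← h2]
  have hd : AEDisjoint volume (q +ᵥ A) (p +ᵥ B) := by
    apply measure_mono_null (t := {p + q}) _ (by simp)
    rintro x ⟨hx1, hx2⟩
    obtain ⟨a, ha, rfl⟩ := hx1
    obtain ⟨b, hb, hab⟩ := hx2
    simp only [vadd_eq_add, Set.mem_singleton_iff] at *
    have := hpm ha
    have := hqm hb
    linarith
  have hm : NullMeasurableSet (p +ᵥ B) volume := (hB.vadd p).measurableSet.nullMeasurableSet
  rw [← measure_union₀ hm hd]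
  apply measure_mono
  refine Set.Subset.trans ?_ hC
  rintro x (⟨a, ha, rfl⟩ | ⟨b, hb, rfl⟩)
  · exact ⟨a, ha, q, hq, by simp [add_comm]⟩
  · exact ⟨p, hp, b, hb, by simp⟩

open scoped Pointwise in
lemma bm_one {A B C : Set ℝ} (hA : MeasurableSet A) (hB : MeasurableSet B)
    (hA0 : A.Nonempty) (hB0 : B.Nonempty) (hC : A + B ⊆ C) :
    volume A + volume B ≤ volume C := by
  obtain ⟨a, ha⟩ := hA0
  obtain ⟨b, hb⟩ := hB0
  have key : ∀ A' ⊆ A, IsCompact A' → ∀ B' ⊆ B, IsCompact B' →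
      volume A' + volume B' ≤ volume C := by
    intro A' hA' cA B' hB' cB
    have := bm_one_compact (A := insert a A') (B := insert b B') (C := C) (cA.insert a)
      (cB.insert b) (Set.insert_nonempty _ _) (Set.insert_nonempty _ _)
      ((Set.add_subset_add (Set.insert_subset ha hA') (Set.insert_subset hb hB')).trans hC)
    refine le_trans (add_le_add ?_ ?_) this <;> exact measure_mono (Set.subset_insert _ _)
  have e : ∀ {D : Set ℝ}, MeasurableSet D →
      volume D = ⨆ K, ⨆ (_ : K ⊆ D ∧ IsCompact K), volume K := by
    intro D hD
    rw [hD.measure_eq_iSup_isCompact volume]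
    simp only [iSup_and]
  rw [e hA, e hB]
  exact ENNReal.biSup_add_biSup_le' ⟨∅, by simp⟩ ⟨∅, by simp⟩
    fun A' h1 B' h2 => key A' h1.1 h1.2 B' h2.1 h2.2

lemma ennreal_amgm {a b : ℝ} (ha : 0 < a) (hb : 0 < b) (hab : a + b = 1) (x y : ENNReal) :
    x ^ a * y ^ b ≤ ENNReal.ofReal a * x + ENNReal.ofReal b * y := by
  rcases eq_or_ne x ⊤ with rfl | hx
  · simp [ENNReal.mul_top, ha]
  rcases eq_or_ne y ⊤ with rfl | hy
  · simp [ENNReal.mul_top, hb]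
  lift x to NNReal using hx
  lift y to NNReal using hy
  lift a to NNReal using ha.le
  lift b to NNReal using hb.le
  have := NNReal.geom_mean_le_arith_mean2_weighted a b x y (by exact_mod_cast hab)
  have h2 := ENNReal.coe_le_coe.2 this
  push_cast at h2
  rw [ENNReal.coe_rpow_of_nonneg _ ha.le, ENNReal.coe_rpow_of_nonneg _ hb.le] at h2
  simpa using h2

lemma layer {f : ℝ → ENNReal} (hf : Measurable f) (h1 : ∀ x, f x ≤ 1) :
    ∫⁻ x, f x = ∫⁻ t in Set.Ioo (0:ℝ) 1, volume {x | ENNReal.ofReal t < f x} := by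
  have hne : ∀ x, f x ≠ ⊤ := fun x => ((h1 x).trans_lt ENNReal.one_lt_top).ne
  have := lintegral_eq_lintegral_meas_lt (f := fun x => (f x).toReal) volume
    (Filter.Eventually.of_forall fun x => ENNReal.toReal_nonneg) hf.ennreal_toReal.aemeasurable
  simp only [ENNReal.ofReal_toReal (hne _)] at this
  rw [this]
  have e : ∀ t : ℝ, 0 ≤ t → {a | t < (f a).toReal} = {x | ENNReal.ofReal t < f x} := by
    intro t ht
    ext x
    simp [ENNReal.ofReal_lt_iff_lt_toReal ht (hne x)]
  rw [← Set.Ioo_union_Ici_eq_Ioi (zero_lt_one (α := ℝ)), lintegral_union measurableSet_Ici]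
  · rw [setLIntegral_congr_fun (g := fun _ => 0) measurableSet_Ici, 
      setLIntegral_congr_fun measurableSet_Ioo]
    · simp
      rfl
    · intro t ht
      simp [e t ht.1.le]
    · intro t ht
      simp only
      rw [e t (zero_le_one.trans ht)]
      convert measure_empty (μ := (volume : Measure ℝ))
      ext x
      simp only [Set.mem_ofPred_eq, Set.mem_empty_iff_false, iff_false, not_lt]
      exact (h1 x).trans (by simpa using ht)
  · rw [Set.disjoint_left]
    intro x hx hx'
    exact absurd hx.2 (not_lt.2 hx')

open scoped Pointwise in
lemma pl_one_norm {a b : ℝ} (ha : 0 < a) (hb : 0 < b) (hab : a + b = 1) {f g h : ℝ → ENNReal}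
    (hf : Measurable f) (hg : Measurable g) (hh : Measurable h)
    (hf1 : ⨆ x, f x = 1) (hg1 : ⨆ x, g x = 1)
    (H : ∀ x y, f x ^ a * g y ^ b ≤ h (a * x + b * y)) :
    (∫⁻ x, f x) ^ a * (∫⁻ x, g x) ^ b ≤ ∫⁻ x, h x := by
  refine (ennreal_amgm ha hb hab _ _).trans ?_
  have hfl : ∀ x, f x ≤ 1 := fun x => hf1 ▸ le_iSup f x
  have hgl : ∀ x, g x ≤ 1 := fun x => hg1 ▸ le_iSup g x
  calc _ ≤ ∫⁻ x, min (h x) 1 := ?_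
    _ ≤ _ := lintegral_mono fun x => min_le_left _ _
  rw [layer hf hfl, layer hg hgl, layer (hh.min measurable_const) (fun x => min_le_right _ _)]
  have mf : Antitone fun t : ℝ => volume {x | ENNReal.ofReal t < f x} := fun s t hst =>
    measure_mono fun x hx => lt_of_le_of_lt (ENNReal.ofReal_le_ofReal hst) hx
  have mg : Antitone fun t : ℝ => volume {x | ENNReal.ofReal t < g x} := fun s t hst =>
    measure_mono fun x hx => lt_of_le_of_lt (ENNReal.ofReal_le_ofReal hst) hx
  rw [← lintegral_const_mul _ mf.measurable, ← lintegral_const_mul _ mg.measurable,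
    ← lintegral_add_left (mf.measurable.const_mul _)]
  apply setLIntegral_mono' measurableSet_Ioo
  intro t ht
  have ht1 : ENNReal.ofReal t < 1 := by simpa using ht.2
  have ht0 : 0 < ENNReal.ofReal t := by simpa using ht.1
  have e1 : ∀ (c : ℝ), 0 < c → ∀ s : Set ℝ, ENNReal.ofReal c * volume s = volume (c • s) := by
    intro c hc s
    rw [Measure.addHaar_smul]; simp [abs_of_pos hc]
  rw [e1 a ha, e1 b hb]
  apply bm_one
  · exact (measurableSet_lt measurable_const hf).const_smul₀ _
  · exact (measurableSet_lt measurable_const hg).const_smul₀ _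
  · obtain ⟨x, hx⟩ := lt_iSup_iff.1 (hf1 ▸ ht1)
    exact Set.Nonempty.smul_set ⟨x, hx⟩
  · obtain ⟨x, hx⟩ := lt_iSup_iff.1 (hg1 ▸ ht1)
    exact Set.Nonempty.smul_set ⟨x, hx⟩
  · rintro _ ⟨_, ⟨x, hx, rfl⟩, _, ⟨y, hy, rfl⟩, rfl⟩
    simp only [Set.mem_ofPred_eq, smul_eq_mul, lt_min_iff] at *
    refine ⟨lt_of_lt_of_le ?_ (H x y), ht1⟩
    calc ENNReal.ofReal t = ENNReal.ofReal t ^ a * ENNReal.ofReal t ^ b := by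
          rw [← ENNReal.rpow_add _ _ ht0.ne' ENNReal.ofReal_ne_top, hab, ENNReal.rpow_one]
      _ < _ := ENNReal.mul_lt_mul (ENNReal.rpow_lt_rpow hx ha) (ENNReal.rpow_lt_rpow hy hb)

lemma pl_one_bdd {a b : ℝ} (ha : 0 < a) (hb : 0 < b) (hab : a + b = 1) {f g h : ℝ → ENNReal}
    (hf : Measurable f) (hg : Measurable g) (hh : Measurable h)
    (hf1 : ⨆ x, f x ≠ ⊤) (hg1 : ⨆ x, g x ≠ ⊤)
    (H : ∀ x y, f x ^ a * g y ^ b ≤ h (a * x + b * y)) :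
    (∫⁻ x, f x) ^ a * (∫⁻ x, g x) ^ b ≤ ∫⁻ x, h x := by
  set S := ⨆ x, f x with hS
  set T := ⨆ x, g x with hT
  rcases eq_or_ne S 0 with h0 | hS0
  · have : ∀ x, f x = 0 := by simpa [hS] using h0
    simp [this, ha]
  rcases eq_or_ne T 0 with h0 | hT0
  · have : ∀ x, g x = 0 := by simpa [hT] using h0
    simp [this, hb]
  have hSa : S ^ a ≠ 0 := by simp [hS0, hf1]
  have hTb : T ^ b ≠ 0 := by simp [hT0, hg1]
  have hSa' : S ^ a ≠ ⊤ := ENNReal.rpow_ne_top_of_nonneg ha.le hf1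
  have hTb' : T ^ b ≠ ⊤ := ENNReal.rpow_ne_top_of_nonneg hb.le hg1
  have := pl_one_norm ha hb hab (f := fun x => S⁻¹ * f x) (g := fun x => T⁻¹ * g x)
    (h := fun x => ((S ^ a)⁻¹ * (T ^ b)⁻¹) * h x) (hf.const_mul _) (hg.const_mul _) (hh.const_mul _)
    (by rw [← ENNReal.mul_iSup, ENNReal.inv_mul_cancel hS0 hf1])
    (by rw [← ENNReal.mul_iSup, ENNReal.inv_mul_cancel hT0 hg1])
    (by
      intro x y
      rw [ENNReal.mul_rpow_of_nonneg _ _ ha.le, ENNReal.mul_rpow_of_nonneg _ _ hb.le,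
        ENNReal.inv_rpow, ENNReal.inv_rpow, mul_mul_mul_comm]
      gcongr
      exact H x y)
  rw [lintegral_const_mul _ hf, lintegral_const_mul _ hg, lintegral_const_mul _ hh,
    ENNReal.mul_rpow_of_nonneg _ _ ha.le, ENNReal.mul_rpow_of_nonneg _ _ hb.le,
        ENNReal.inv_rpow, ENNReal.inv_rpow, mul_mul_mul_comm] at this
  rwa [ENNReal.mul_le_mul_iff_right] at this
  · simp [hSa', hTb']
  · exact ENNReal.mul_ne_top (by simp [hSa]) (by simp [hTb])

lemma lint_trunc {f : ℝ → ENNReal} (hf : Measurable f) {a : ℝ} (ha : 0 < a) :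
    (∫⁻ x, f x) ^ a = ⨆ k : ℕ, (∫⁻ x, min (f x) k) ^ a := by
  have : ∀ x, f x = ⨆ k : ℕ, min (f x) k := by
    intro x
    have := (inf_iSup_eq (f x) (fun k : ℕ => (k : ENNReal)))
    rw [ENNReal.iSup_natCast] at this
    simpa using this
  rw [lintegral_congr this, lintegral_iSup]
  · exact (ENNReal.orderIsoRpow a ha).map_iSup _
  · exact fun n => hf.min measurable_const
  · intro i j hij x
    exact min_le_min_left _ (by exact_mod_cast hij)

lemma pl_one {a b : ℝ} (ha : 0 < a) (hb : 0 < b) (hab : a + b = 1) {f g h : ℝ → ENNReal}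
    (hf : Measurable f) (hg : Measurable g) (hh : Measurable h)
    (H : ∀ x y, f x ^ a * g y ^ b ≤ h (a * x + b * y)) :
    (∫⁻ x, f x) ^ a * (∫⁻ x, g x) ^ b ≤ ∫⁻ x, h x := by
  rw [lint_trunc hf ha, lint_trunc hg hb]
  simp only [ENNReal.iSup_mul, ENNReal.mul_iSup]
  refine iSup_le fun i => iSup_le fun j => ?_
  refine pl_one_bdd ha hb hab (hf.min measurable_const) (hg.min measurable_const) hh ?_ ?_ ?_
  · exact ne_top_of_le_ne_top (ENNReal.natCast_ne_top _) (iSup_le fun x => min_le_right _ _)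
  · exact ne_top_of_le_ne_top (ENNReal.natCast_ne_top _) (iSup_le fun x => min_le_right _ _)
  · intro x y
    refine le_trans ?_ (H x y)
    gcongr <;> exact min_le_left _ _

lemma pl_fin {a b : ℝ} (ha : 0 < a) (hb : 0 < b) (hab : a + b = 1) (n : ℕ) :
    ∀ {f g h : (Fin n → ℝ) → ENNReal},
    Measurable f → Measurable g → Measurable h →
    (∀ x y, f x ^ a * g y ^ b ≤ h (a • x + b • y)) →
    (∫⁻ x, f x) ^ a * (∫⁻ x, g x) ^ b ≤ ∫⁻ x, h x := by
  induction n with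
  | zero =>
    intro f g h hf hg hh H
    have e : ∀ F : (Fin 0 → ℝ) → ENNReal, ∫⁻ x, F x = F default := by
      intro F
      rw [lintegral_unique]
      simp only [volume_pi, Measure.pi_empty_univ, mul_one]
      exact congrArg F (Subsingleton.elim _ _)
    rw [e, e, e]
    convert H default default
  | succ n ih =>
    intro f g h hf hg hh H
    have mp := (volume_preserving_piFinSuccAbove (fun _ : Fin (n+1) => ℝ) 0).symm
    have hcons : ∀ (t : ℝ) (y : Fin n → ℝ),
        (MeasurableEquiv.piFinSuccAbove (fun _ : Fin (n+1) => ℝ) 0).symm (t, y) = Fin.cons t y := by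
      intro t y
      simp [MeasurableEquiv.piFinSuccAbove, Fin.insertNthEquiv]
    have key : ∀ {F : (Fin (n+1) → ℝ) → ENNReal}, Measurable F →
        ∫⁻ x, F x = ∫⁻ t : ℝ, ∫⁻ y : Fin n → ℝ, F (Fin.cons t y) := by
      intro F hF
      rw [← mp.lintegral_comp hF, Measure.volume_eq_prod, lintegral_prod _ (by fun_prop)]
      simp only [hcons]
    have mc : Measurable fun p : ℝ × (Fin n → ℝ) => (Fin.cons p.1 p.2 : Fin (n+1) → ℝ) := by
      simp only [← hcons]
      exact (MeasurableEquiv.piFinSuccAbove (fun _ : Fin (n+1) => ℝ) 0).symm.measurable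
    have mm : ∀ {F : (Fin (n+1) → ℝ) → ENNReal}, Measurable F →
        Measurable fun t : ℝ => ∫⁻ y : Fin n → ℝ, F (Fin.cons t y) := by
      intro F hF
      exact Measurable.lintegral_prod_right' (f := fun p : ℝ × (Fin n → ℝ) => F (Fin.cons p.1 p.2)) (hF.comp mc)
    have ms : ∀ {F : (Fin (n+1) → ℝ) → ENNReal}, Measurable F → ∀ t : ℝ,
        Measurable fun y : Fin n → ℝ => F (Fin.cons t y) := by
      intro F hF t
      exact (hF.comp mc).comp measurable_prodMk_left
    rw [key hf, key hg, key hh]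
    apply pl_one ha hb hab (mm hf) (mm hg) (mm hh)
    intro s t
    apply ih (ms hf s) (ms hg t) (ms hh _)
    intro x y
    convert H (Fin.cons s x) (Fin.cons t y) using 2
    ext i
    refine Fin.cases ?_ (fun j => ?_) i <;> simp

open scoped Pointwise in
lemma bm_mult {n : ℕ} {a b : ℝ} (ha : 0 < a) (hb : 0 < b) (hab : a + b = 1)
    {A B : Set (EuclideanSpace ℝ (Fin n))} (hA : IsCompact A) (hB : IsCompact B) :
    volume A ^ a * volume B ^ b ≤ volume (a • A + b • B) := by
  have hC : IsCompact (a • A + b • B) := (hA.smul a).add (hB.smul b)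
  have mp := PiLp.volume_preserving_toLp (Fin n)
  have key : ∀ {D : Set (EuclideanSpace ℝ (Fin n))}, MeasurableSet D →
      volume D = ∫⁻ x : Fin n → ℝ, D.indicator (fun _ => 1) (WithLp.toLp 2 x) := by
    intro D hD
    rw [mp.lintegral_comp (measurable_const.indicator hD)]
    simp [lintegral_indicator hD]
  have hm : ∀ {D : Set (EuclideanSpace ℝ (Fin n))}, MeasurableSet D →
      Measurable fun x : Fin n → ℝ => D.indicator (fun _ => (1 : ENNReal)) (WithLp.toLp 2 x) :=
    fun hD => (measurable_const.indicator hD).comp mp.measurable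
  rw [key hA.measurableSet, key hB.measurableSet, key hC.measurableSet]
  apply pl_fin ha hb hab n (hm hA.measurableSet) (hm hB.measurableSet) (hm hC.measurableSet)
  intro x y
  by_cases hx : WithLp.toLp 2 x ∈ A
  · by_cases hy : WithLp.toLp 2 y ∈ B
    · have : WithLp.toLp 2 (a • x + b • y) ∈ a • A + b • B :=
        ⟨_, ⟨_, hx, rfl⟩, _, ⟨_, hy, rfl⟩, rfl⟩
      rw [Set.indicator_of_mem this]
      simp [hx, hy]
    · simp [hy, hb]
  · simp [hx, ha]

lemma unif_dist {X : Type*} [MetricSpace X] [CompactSpace X] [MeasurableSpace X] [BorelSpace X]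
    (μ ν : Measure X) [IsFiniteMeasure μ] [IsFiniteMeasure ν]
    (hμ : ∀ x y r, μ (Metric.ball x r) = μ (Metric.ball y r))
    (hν : ∀ x y r, ν (Metric.ball x r) = ν (Metric.ball y r))
    (hpos : ∀ x r, 0 < r → 0 < ν (Metric.ball x r))
    {f : X → ℝ} (hf : Continuous f) :
    μ.real Set.univ * ∫ x, f x ∂ν = ν.real Set.univ * ∫ x, f x ∂μ := by
  rcases isEmpty_or_nonempty X with hX | ⟨⟨x0⟩⟩
  · simp [Measure.eq_zero_of_isEmpty]
  -- swapped double integral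
  have swap : ∀ (F : X → ℝ), Continuous F → ∀ r,
      Integrable (fun x => ∫ y in Metric.ball x r, F y ∂ν) μ ∧
      ∫ x, (∫ y in Metric.ball x r, F y ∂ν) ∂μ = μ.real (Metric.ball x0 r) * ∫ y, F y ∂ν := by
    intro F hF r
    obtain ⟨C, hC⟩ := isCompact_univ.exists_bound_of_continuousOn hF.continuousOn
    have hm : MeasurableSet {p : X × X | dist p.2 p.1 < r} :=
      (isOpen_lt (by fun_prop) (by fun_prop)).measurableSet
    have hFint : Integrable (Function.uncurry fun x y => (Metric.ball x r).indicator F y)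
        (μ.prod ν) := by
      have : (Function.uncurry fun x y => (Metric.ball x r).indicator F y) =
          {p : X × X | dist p.2 p.1 < r}.indicator (fun p => F p.2) := by
        ext ⟨x, y⟩
        simp [Set.indicator, Function.uncurry]
      rw [this]
      apply Integrable.indicator _ hm
      exact Integrable.of_bound (hF.comp continuous_snd).measurable.aestronglyMeasurable C
        (Filter.Eventually.of_forall fun p => hC _ trivial)
    have h1 := integral_integral_swap hFint
    simp only [integral_indicator Metric.isOpen_ball.measurableSet] at h1
    have h2 := hFint.integral_prod_left
    simp only [Function.uncurry, integral_indicator Metric.isOpen_ball.measurableSet] at h2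
    refine ⟨h2, ?_⟩
    rw [h1, ← integral_const_mul]
    congr 1
    ext y
    have : (fun x => (Metric.ball x r).indicator F y) = (Metric.ball y r).indicator fun _ => F y := by
      ext x
      simp [Set.indicator, dist_comm]
    rw [this, integral_indicator Metric.isOpen_ball.measurableSet]
    simp [measureReal_def, hμ y x0 r]
  set m := μ.real Set.univ
  set v := ν.real Set.univ
  have hm0 : 0 ≤ m := measureReal_nonneg
  have hv0 : 0 ≤ v := measureReal_nonneg
  have key : ∀ ε > 0, |m * ∫ x, f x ∂ν - v * ∫ x, f x ∂μ| ≤ ε * (m * v) := by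
    intro ε hε
    obtain ⟨r, hr, hfr⟩ := Metric.uniformContinuous_iff.1
      (CompactSpace.uniformContinuous_of_continuous hf) ε hε
    set g := μ.real (Metric.ball x0 r)
    set h := ν.real (Metric.ball x0 r)
    have hh : 0 < h := ENNReal.toReal_pos (hpos x0 r hr).ne' (measure_ne_top _ _)
    have hball : ∀ x, ν.real (Metric.ball x r) = h := fun x => by
      simp [h, measureReal_def, hν x x0 r]
    have e1 : m * h = g * v := by
      have := swap (fun _ => 1) continuous_const r |>.2
      simp [hball] at this
      simpa using this
    obtain ⟨hI, e2⟩ := swap f hf r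
    have hfi : Integrable f μ := by
      obtain ⟨C, hC⟩ := isCompact_univ.exists_bound_of_continuousOn hf.continuousOn
      exact Integrable.of_bound hf.measurable.aestronglyMeasurable C
        (Filter.Eventually.of_forall fun p => hC _ trivial)
    have hfi' : Integrable f ν := by
      obtain ⟨C, hC⟩ := isCompact_univ.exists_bound_of_continuousOn hf.continuousOn
      exact Integrable.of_bound hf.measurable.aestronglyMeasurable C
        (Filter.Eventually.of_forall fun p => hC _ trivial)
    have pt : ∀ x, |(∫ y in Metric.ball x r, f y ∂ν) - h * f x| ≤ ε * h := by
      intro x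
      have : h * f x = ∫ y in Metric.ball x r, f x ∂ν := by simp [hball]
      rw [this, ← integral_sub hfi'.integrableOn (by simp), ← hball x, ← Real.norm_eq_abs]
      apply norm_setIntegral_le_of_norm_le_const (measure_lt_top _ _)
      intro y hy
      rw [← dist_eq_norm]
      exact (hfr hy).le
    have e3 : |g * ∫ y, f y ∂ν - h * ∫ x, f x ∂μ| ≤ ε * h * m := by
      rw [← e2, ← integral_const_mul, ← integral_sub hI (hfi.const_mul _), ← Real.norm_eq_abs]
      exact norm_integral_le_of_norm_le_const (C := ε * h)
          (Filter.Eventually.of_forall fun x => pt x)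
    have e4 : |m * ∫ x, f x ∂ν - v * ∫ x, f x ∂μ| * h = |g * ∫ y, f y ∂ν - h * ∫ x, f x ∂μ| * v := by
      have t1 : ∀ z : ℝ, |z| * h = |z * h| := fun z => by rw [abs_mul, abs_of_pos hh]
      have t2 : ∀ z : ℝ, |z| * v = |z * v| := fun z => by rw [abs_mul, abs_of_nonneg hv0]
      rw [t1, t2]
      congr 1
      linear_combination (∫ x, f x ∂ν) * e1
    have : |m * ∫ x, f x ∂ν - v * ∫ x, f x ∂μ| * h ≤ (ε * (m * v)) * h := by
      rw [e4]
      calc _ ≤ (ε * h * m) * v := by gcongr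
        _ = _ := by ring
    exact le_of_mul_le_mul_right this hh
  have : |m * ∫ x, f x ∂ν - v * ∫ x, f x ∂μ| ≤ 0 := by
    refine le_of_forall_pos_le_add fun δ hδ => ?_
    have hmv : 0 ≤ m * v := by positivity
    refine (key (δ / (m * v + 1)) (by positivity)).trans ?_
    rw [zero_add, div_mul_eq_mul_div, div_le_iff₀ (by positivity)]
    nlinarith
  have := abs_nonpos_iff.1 this
  linarith

open scoped Pointwise in
lemma sphere_iso {n : ℕ} (x y : Metric.sphere (0 : EuclideanSpace ℝ (Fin n)) 1) :
    ∃ e : EuclideanSpace ℝ (Fin n) ≃ₗᵢ[ℝ] EuclideanSpace ℝ (Fin n), ∀ r,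
      e '' (Subtype.val '' Metric.ball x r) = Subtype.val '' Metric.ball y r := by
  have hxy : ‖(x : EuclideanSpace ℝ (Fin n))‖ = ‖(y : EuclideanSpace ℝ (Fin n))‖ := by simp
  have h1 := Submodule.reflection_sub hxy
  set e := (ℝ ∙ ((x : EuclideanSpace ℝ (Fin n)) - y))ᗮ.reflection
  refine ⟨e, fun r => ?_⟩
  have hy : e y = x := by rw [← h1]; simp [e]
  ext z
  constructor
  · rintro ⟨_, ⟨w, hw, rfl⟩, rfl⟩
    refine ⟨⟨e w, by simp⟩, ?_, rfl⟩
    rw [Metric.mem_ball, Subtype.dist_eq] at *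
    rwa [← h1, e.dist_map]
  · rintro ⟨w, hw, rfl⟩
    refine ⟨e w, ⟨⟨e w, by simp⟩, ?_, rfl⟩, by simp [e]⟩
    rw [Metric.mem_ball, Subtype.dist_eq] at *
    rwa [← hy, e.dist_map]

open scoped Pointwise in
lemma toSphere_ball {n : ℕ} (x y : Metric.sphere (0 : EuclideanSpace ℝ (Fin n)) 1) (r : ℝ) :
    (volume : Measure (EuclideanSpace ℝ (Fin n))).toSphere (Metric.ball x r) =
    (volume : Measure (EuclideanSpace ℝ (Fin n))).toSphere (Metric.ball y r) := by
  obtain ⟨e, he⟩ := sphere_iso x y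
  rw [Measure.toSphere_apply' _ Metric.isOpen_ball.measurableSet,
    Measure.toSphere_apply' _ Metric.isOpen_ball.measurableSet, ← he r]
  congr 1
  have : Set.Ioo (0:ℝ) 1 • e '' (Subtype.val '' Metric.ball x r) =
      e '' (Set.Ioo (0:ℝ) 1 • Subtype.val '' Metric.ball x r) := by
    rw [← Set.image2_smul, ← Set.image2_smul, Set.image_image2, Set.image2_image_right]
    simp
  rw [this]
  have h2 := e.measurePreserving.symm e.toHomeomorph.toMeasurableEquiv
  have h3 := h2.measure_preimage_equiv (Set.Ioo (0:ℝ) 1 • Subtype.val '' Metric.ball x r)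
  rw [← h3]
  congr 1
  exact (e.toEquiv.image_eq_preimage_symm _).symm

lemma haus_ball {n : ℕ} (d : ℝ) (x y : Metric.sphere (0 : EuclideanSpace ℝ (Fin n)) 1) (r : ℝ) :
    ((μH[d] : Measure (EuclideanSpace ℝ (Fin n))).comap Subtype.val :
      Measure (Metric.sphere (0 : EuclideanSpace ℝ (Fin n)) 1)) (Metric.ball x r) =
    ((μH[d] : Measure (EuclideanSpace ℝ (Fin n))).comap Subtype.val :
      Measure (Metric.sphere (0 : EuclideanSpace ℝ (Fin n)) 1)) (Metric.ball y r) := by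
  obtain ⟨e, he⟩ := sphere_iso x y
  have hs : MeasurableSet (Metric.sphere (0 : EuclideanSpace ℝ (Fin n)) 1) :=
    Metric.isClosed_sphere.measurableSet
  rw [(MeasurableEmbedding.subtype_coe hs).comap_apply,
    (MeasurableEmbedding.subtype_coe hs).comap_apply, ← he r]
  exact (e.toIsometryEquiv.hausdorffMeasure_image d _).symm

lemma normalize_lip {E : Type*} [NormedAddCommGroup E] [NormedSpace ℝ E] :
    LipschitzOnWith 2 (fun x : E => ‖x‖⁻¹ • x) {x | 1 ≤ ‖x‖} := by
  apply LipschitzOnWith.of_dist_le_mul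
  intro x hx y hy
  simp only [Set.mem_ofPred_eq] at hx hy
  have hx0 : 0 < ‖x‖ := by linarith
  have hy0 : 0 < ‖y‖ := by linarith
  have e : ‖x‖⁻¹ • x - ‖y‖⁻¹ • y = ‖x‖⁻¹ • (x - y) + (‖x‖⁻¹ - ‖y‖⁻¹) • y := by
    module
  rw [dist_eq_norm, dist_eq_norm, e]
  refine (norm_add_le _ _).trans ?_
  rw [norm_smul, norm_smul, norm_inv, norm_norm]
  have h1 : ‖x‖⁻¹ * ‖x - y‖ ≤ ‖x - y‖ := mul_le_of_le_one_left (norm_nonneg _) (inv_le_one_of_one_le₀ hx)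
  have h2 : ‖‖x‖⁻¹ - ‖y‖⁻¹‖ * ‖y‖ = ‖x‖⁻¹ * |‖y‖ - ‖x‖| := by
    have : ‖x‖⁻¹ - ‖y‖⁻¹ = ‖x‖⁻¹ * ‖y‖⁻¹ * (‖y‖ - ‖x‖) := by field_simp
    rw [this, Real.norm_eq_abs, abs_mul, abs_of_pos (by positivity)]
    field_simp
  have h3 : ‖x‖⁻¹ * |‖y‖ - ‖x‖| ≤ ‖x - y‖ := by
    refine (mul_le_of_le_one_left (abs_nonneg _) (inv_le_one_of_one_le₀ hx)).trans ?_
    rw [norm_sub_rev]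
    exact abs_norm_sub_norm_le y x
  rw [h2]
  push_cast
  linarith

lemma haus_fin (m : ℕ) :
    μH[(m : ℝ)] (Metric.sphere (0 : EuclideanSpace ℝ (Fin (m+1))) 1) < ⊤ := by
  let φ : Fin (m+1) → ℝ → (Fin m → ℝ) → EuclideanSpace ℝ (Fin (m+1)) :=
    fun i s y => WithLp.toLp 2 (i.insertNth s y)
  let N : EuclideanSpace ℝ (Fin (m+1)) → EuclideanSpace ℝ (Fin (m+1)) := fun x => ‖x‖⁻¹ • x
  let Q : Set (Fin m → ℝ) := Metric.closedBall 0 1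
  have hQ : μH[(m : ℝ)] Q < ⊤ := by
    have := hausdorffMeasure_pi_real (ι := Fin m)
    rw [Fintype.card_fin] at this
    rw [this]
    exact measure_closedBall_lt_top
  obtain ⟨C, hC⟩ : ∃ C, LipschitzWith C (WithLp.toLp 2 : (Fin (m+1) → ℝ) → EuclideanSpace ℝ (Fin (m+1))) :=
    ⟨_, PiLp.lipschitzWith_toLp 2 _⟩
  have hφ : ∀ i s, LipschitzWith C (φ i s) := by
    intro i s
    have : LipschitzWith 1 (fun y : Fin m → ℝ => (i.insertNth s y : Fin (m+1) → ℝ)) := by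
      apply LipschitzWith.of_dist_le_mul
      intro y z
      rw [NNReal.coe_one, one_mul, dist_pi_le_iff dist_nonneg]
      intro j
      refine Fin.succAboveCases i ?_ (fun k => ?_) j
      · simp
      · simpa using dist_le_pi_dist y z k
    have h := hC.comp this
    rw [mul_one] at h
    exact h
  have hbig : ∀ i (s : ℝ), |s| = 1 → ∀ y, 1 ≤ ‖φ i s y‖ := by
    intro i s hs y
    have := PiLp.norm_apply_le (φ i s y) i
    simpa [φ, hs] using this
  have hcover : Metric.sphere (0 : EuclideanSpace ℝ (Fin (m+1))) 1 ⊆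
      ⋃ i : Fin (m+1), ((N ∘ φ i 1) '' Q ∪ (N ∘ φ i (-1)) '' Q) := by
    intro x hx
    have hx1 : ‖x‖ = 1 := by simpa using hx
    obtain ⟨i, -, hi⟩ := Finset.exists_max_image Finset.univ (fun i => |x i|) Finset.univ_nonempty
    have hi0 : 0 < |x i| := by
      by_contra hcon
      have : x = 0 := by
        ext j
        have := hi j (Finset.mem_univ _)
        have := abs_nonneg (x j)
        exact abs_eq_zero.1 (by linarith)
      simp [this] at hx1
    set t := |x i| with ht
    have gen : ∀ s : ℝ, s = x i / t → x ∈ (N ∘ φ i s) '' Q := by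
      intro s hs
      refine ⟨fun k => x (i.succAbove k) / t, ?_, ?_⟩
      · simp only [Q, mem_closedBall_zero_iff]
        rw [pi_norm_le_iff_of_nonneg zero_le_one]
        intro k
        rw [norm_div, Real.norm_eq_abs, Real.norm_eq_abs, abs_of_pos hi0, div_le_one hi0]
        exact hi _ (Finset.mem_univ _)
      · have : φ i s (fun k => x (i.succAbove k) / t) = t⁻¹ • x := by
          ext j
          refine Fin.succAboveCases i ?_ (fun k => ?_) j
          · simp [φ, hs]; ring
          · simp [φ]; ring
        simp only [Function.comp, this, N]
        rw [norm_smul, hx1, norm_inv, Real.norm_eq_abs, abs_of_pos hi0, mul_one, inv_inv,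
          smul_smul, mul_inv_cancel₀ hi0.ne', one_smul]
    rw [Set.mem_iUnion]
    refine ⟨i, ?_⟩
    rcases abs_cases (x i) with ⟨h, _⟩ | ⟨h, _⟩
    · left; apply gen; rw [ht, h, div_self]; rw [← h]; exact hi0.ne'
    · right; apply gen; rw [ht, h, div_neg, div_self]; intro h0; rw [ht, h0] at hi0; simp at hi0
  have hpiece : ∀ i (s : ℝ), |s| = 1 → μH[(m : ℝ)] ((N ∘ φ i s) '' Q) < ⊤ := by
    intro i s hs
    have hl : LipschitzOnWith (2 * C) (N ∘ φ i s) Q :=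
      normalize_lip.comp (hφ i s).lipschitzOnWith (fun y _ => hbig i s hs y)
    refine (hl.hausdorffMeasure_image_le (Nat.cast_nonneg m)).trans_lt ?_
    exact ENNReal.mul_lt_top (ENNReal.rpow_lt_top_of_nonneg (Nat.cast_nonneg m) ENNReal.coe_ne_top) hQ
  refine (measure_mono hcover).trans_lt ?_
  refine (measure_iUnion_fintype_le _ _).trans_lt ?_
  refine ENNReal.sum_lt_top.2 fun i _ => ?_
  exact (measure_union_le _ _).trans_lt (ENNReal.add_lt_top.2 ⟨hpiece i 1 (by simp), hpiece i (-1) (by simp)⟩)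

lemma haus_pos (m : ℕ) :
    0 < μH[(m : ℝ)] (Metric.sphere (0 : EuclideanSpace ℝ (Fin (m+1))) 1) := by
  let p : EuclideanSpace ℝ (Fin (m+1)) → (Fin m → ℝ) := fun x k => x k.succ
  have hp : LipschitzWith 1 p := by
    apply LipschitzWith.of_dist_le_mul
    intro y z
    rw [NNReal.coe_one, one_mul, dist_pi_le_iff dist_nonneg]
    intro j
    have := PiLp.norm_apply_le (y - z) j.succ
    simpa [p, dist_eq_norm] using this
  have h1 := (hp.lipschitzOnWith (s := Metric.sphere (0 : EuclideanSpace ℝ (Fin (m+1))) 1)).hausdorffMeasure_image_le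
    (Nat.cast_nonneg (α := ℝ) m)
  rw [ENNReal.coe_one, ENNReal.one_rpow, one_mul] at h1
  refine lt_of_lt_of_le ?_ h1
  let U : Set (Fin m → ℝ) := {y | ∑ k, y k ^ 2 < 1}
  have hU : IsOpen U := isOpen_lt (by fun_prop) continuous_const
  have hsub : U ⊆ p '' (Metric.sphere (0 : EuclideanSpace ℝ (Fin (m+1))) 1) := by
    intro y hy
    have hy' : ∑ k, y k ^ 2 < 1 := hy
    refine ⟨WithLp.toLp 2 (Fin.cons (√(1 - ∑ k, y k ^ 2)) y), ?_, ?_⟩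
    · rw [mem_sphere_zero_iff_norm, EuclideanSpace.norm_eq, Real.sqrt_eq_one, Fin.sum_univ_succ]
      simp [Real.sq_sqrt (sub_nonneg.2 hy'.le)]
    · ext k
      simp [p]
  refine lt_of_lt_of_le ?_ (measure_mono hsub)
  have := hausdorffMeasure_pi_real (ι := Fin m)
  rw [Fintype.card_fin] at this
  rw [this]
  exact hU.measure_pos _ ⟨0, by simp [U]⟩

lemma polar_le (m : ℕ) (L : Set (EuclideanSpace ℝ (Fin (m+1))))
    (ρ : Metric.sphere (0 : EuclideanSpace ℝ (Fin (m+1))) 1 → ℝ) (hρ : Continuous ρ)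
    (hpos : ∀ u, 0 < ρ u)
    (hL : ∀ (u : Metric.sphere (0 : EuclideanSpace ℝ (Fin (m+1))) 1) (r : ℝ), 0 < r →
      r • (u : EuclideanSpace ℝ (Fin (m+1))) ∈ L → r < ρ u) :
    volume L ≤ ∫⁻ u, ENNReal.ofReal (ρ u ^ (m+1) / (m+1))
      ∂(volume : Measure (EuclideanSpace ℝ (Fin (m+1)))).toSphere := by
  let E := EuclideanSpace ℝ (Fin (m+1))
  have hΦ := (volume : Measure E).measurePreserving_homeomorphUnitSphereProd
  have hdim : Module.finrank ℝ E - 1 = m := by simp [E]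
  rw [hdim] at hΦ
  let W : Set (Metric.sphere (0 : E) 1 × Set.Ioi (0:ℝ)) := {p | (p.2 : ℝ) < ρ p.1}
  have hW : MeasurableSet W := (isOpen_lt (by fun_prop) (by fun_prop)).measurableSet
  have h0 : MeasurableSet ({0}ᶜ : Set E) := (measurableSet_singleton _).compl
  calc volume L = volume (L \ {0}) := (measure_sdiff_null (measure_singleton _)).symm
    _ ≤ volume (Subtype.val '' (homeomorphUnitSphereProd E ⁻¹' W)) := by
        apply measure_mono
        rintro x ⟨hx, hx0⟩
        refine ⟨⟨x, hx0⟩, ?_, rfl⟩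
        have hx0' : x ≠ 0 := hx0
        simp only [Set.mem_preimage, W, Set.mem_ofPred_eq, homeomorphUnitSphereProd_apply_snd_coe]
        apply hL
        · exact norm_pos_iff.2 hx0'
        · rw [homeomorphUnitSphereProd_apply_fst_coe, smul_smul, mul_inv_cancel₀ (norm_ne_zero_iff.2 hx0'), one_smul]
          exact hx
    _ = (volume.comap Subtype.val) (homeomorphUnitSphereProd E ⁻¹' W) := by
        rw [(MeasurableEmbedding.subtype_coe h0).comap_apply]
    _ = _ := by
        rw [hΦ.measure_preimage hW.nullMeasurableSet, Measure.prod_apply hW]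
        congr 1
        ext u
        have : Prod.mk u ⁻¹' W = Set.Iio (⟨ρ u, hpos u⟩ : Set.Ioi (0:ℝ)) := by
          ext r
          simp [W, ← Subtype.coe_lt_coe]
        rw [this, Measure.volumeIoiPow_apply_Iio]

lemma pow_taylor (n : ℕ) : ∃ C : ℝ, 0 ≤ C ∧ ∀ x : ℝ, |x| ≤ 1 →
    (1 + x) ^ n ≤ 1 + n * x + C * x ^ 2 := by
  induction n with
  | zero => exact ⟨0, le_rfl, fun x _ => by simp⟩
  | succ n ih =>
    obtain ⟨C, hC, h⟩ := ih
    refine ⟨n + 2 * C, by positivity, fun x hx => ?_⟩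
    have h1 := h x hx
    obtain ⟨h2, h3⟩ := abs_le.1 hx
    rw [pow_succ]
    have h4 : (1 + x) ^ n * (1 + x) ≤ (1 + n * x + C * x ^ 2) * (1 + x) :=
      mul_le_mul_of_nonneg_right h1 (by linarith)
    have h5 : 0 ≤ C * x ^ 2 * (1 - x) := mul_nonneg (by positivity) (by linarith)
    push_cast
    nlinarith

lemma suppFn_bdd {n : ℕ} {K : Set (EuclideanSpace ℝ (Fin n))} (hK : IsCompact K)
    (u : EuclideanSpace ℝ (Fin n)) : BddAbove ((fun x => ⟪x, u⟫) '' K) :=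
  (hK.image (by fun_prop)).bddAbove

lemma suppFn_cont {n : ℕ} {K : Set (EuclideanSpace ℝ (Fin n))} (hK : IsCompact K)
    (hne : K.Nonempty) : Continuous (suppFn K) := by
  obtain ⟨R, hR⟩ := hK.isBounded.exists_norm_le
  have hR0 : 0 ≤ R := by
    obtain ⟨x, hx⟩ := hne
    exact (norm_nonneg x).trans (hR x hx)
  have : LipschitzWith ⟨R, hR0⟩ (suppFn K) := by
    apply LipschitzWith.of_le_add_mul
    intro u v
    apply csSup_le (hne.image _)
    rintro _ ⟨x, hx, rfl⟩
    have h1 : ⟪x, v⟫ ≤ suppFn K v := le_csSup (suppFn_bdd hK v) ⟨x, hx, rfl⟩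
    have h2 : ⟪x, u⟫ = ⟪x, v⟫ + ⟪x, u - v⟫ := by rw [inner_sub_right]; ring
    have h3 : ⟪x, u - v⟫ ≤ R * ‖u - v‖ := (real_inner_le_norm _ _).trans (by gcongr; exact hR x hx)
    simp only
    rw [h2, dist_eq_norm]
    exact add_le_add h1 h3
  exact this.continuous

open scoped Pointwise in
lemma toSphere_ineq (m : ℕ) (K : Set (EuclideanSpace ℝ (Fin (m+1))))
    (hK : IsCompact K) (hne : K.Nonempty) (κ : ℝ) (hκ : 0 < κ)
    (hvol : volume K = ENNReal.ofReal (κ ^ (m+1)) *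
      volume (Metric.closedBall (0 : EuclideanSpace ℝ (Fin (m+1))) 1)) :
    κ * (volume : Measure (EuclideanSpace ℝ (Fin (m+1)))).toSphere.real Set.univ ≤
      ∫ u, suppFn K u ∂(volume : Measure (EuclideanSpace ℝ (Fin (m+1)))).toSphere := by
  set τ := (volume : Measure (EuclideanSpace ℝ (Fin (m+1)))).toSphere with hτ
  set T := τ.real Set.univ with hT
  have hT0 : 0 ≤ T := measureReal_nonneg
  set B := Metric.closedBall (0 : EuclideanSpace ℝ (Fin (m+1))) 1 with hB
  have hBc : IsCompact B := isCompact_closedBall _ _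
  have hn : (0 : ℝ) < m + 1 := by positivity
  have hTV : volume B = ENNReal.ofReal (T / (m+1)) := by
    rw [hT, hτ, Measure.toSphere_real_apply_univ, hB, Measure.addHaar_closedBall_eq_addHaar_ball]
    simp only [finrank_euclideanSpace, Fintype.card_fin]
    push_cast
    rw [mul_div_cancel_left₀ _ hn.ne', ofReal_measureReal]
  have hsc : Continuous fun u : Metric.sphere (0 : EuclideanSpace ℝ (Fin (m+1))) 1 => suppFn K u :=
    (suppFn_cont hK hne).comp continuous_subtype_val
  have intg : ∀ F : Metric.sphere (0 : EuclideanSpace ℝ (Fin (m+1))) 1 → ℝ, Continuous F →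
      Integrable F τ := by
    intro F hF
    obtain ⟨C, hC⟩ := isCompact_univ.exists_bound_of_continuousOn hF.continuousOn
    exact Integrable.of_bound hF.measurable.aestronglyMeasurable C
        (Filter.Eventually.of_forall fun p => hC _ trivial)
  obtain ⟨C, hC0, hC⟩ := pow_taylor (m+1)
  -- first-order argument for every `η`
  have key : ∀ η > 0, 0 ≤ ∫ u, (κ⁻¹ * suppFn K u - 1 + η) ∂τ := by
    intro η hη
    set g : Metric.sphere (0 : EuclideanSpace ℝ (Fin (m+1))) 1 → ℝ :=
      fun u => κ⁻¹ * suppFn K u - 1 + η with hg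
    have hgc : Continuous g := by fun_prop
    obtain ⟨G, hG⟩ := isCompact_univ.exists_bound_of_continuousOn hgc.continuousOn
    have hG' : ∀ u, |g u| ≤ |G| := fun u => (hG u trivial).trans (le_abs_self G)
    have step : ∀ l : ℝ, 0 < l → l < 1 → l * (|G| + 1) < 1 →
        0 ≤ (m+1) * ∫ u, g u ∂τ + l * (C * G ^ 2 * T) := by
      intro l hl hl1 hlG
      have hlg : ∀ u, |l * g u| < 1 := by
        intro u
        rw [abs_mul, abs_of_pos hl]
        have := hG' u
        nlinarith
      have hpos : ∀ u, 0 < 1 + l * g u := fun u => by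
        have := (abs_lt.1 (hlg u)).1
        linarith
      have h1 := bm_mult (a := 1 - l) (b := l) (by linarith) hl (by ring) hBc (hK.smul κ⁻¹)
      have hK' : volume (κ⁻¹ • K) = volume B := by
        rw [Measure.addHaar_smul, hvol, ← mul_assoc, ← ENNReal.ofReal_mul (abs_nonneg _)]
        rw [finrank_euclideanSpace, Fintype.card_fin, abs_of_pos (by positivity), ← mul_pow,
          inv_mul_cancel₀ hκ.ne']
        simp
      rw [hK', ← ENNReal.rpow_add_of_nonneg _ _ (by linarith) hl.le, sub_add_cancel,
        ENNReal.rpow_one] at h1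
      have h2 := polar_le m ((1 - l) • B + l • κ⁻¹ • K) (fun u => 1 + l * g u) (by fun_prop) hpos (by
        intro u r hr hmem
        obtain ⟨_, ⟨b, hb, rfl⟩, _, ⟨_, ⟨k, hk, rfl⟩, rfl⟩, hsum⟩ := hmem
        have hu : ‖(u : EuclideanSpace ℝ (Fin (m+1)))‖ = 1 := by simp
        have e1 : r = ⟪r • (u : EuclideanSpace ℝ (Fin (m+1))), u⟫ := by
          rw [real_inner_smul_left, real_inner_self_eq_norm_sq, hu]; ring
        have e2 : ⟪b, (u : EuclideanSpace ℝ (Fin (m+1)))⟫ ≤ 1 := by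
          refine (real_inner_le_norm _ _).trans ?_
          rw [hu, mul_one]
          simpa [hB] using hb
        have e3 : ⟪k, (u : EuclideanSpace ℝ (Fin (m+1)))⟫ ≤ suppFn K u :=
          le_csSup (suppFn_bdd hK u) ⟨k, hk, rfl⟩
        rw [← hsum] at e1
        simp only [inner_add_left, real_inner_smul_left] at e1
        have e4 : (1 - l) * ⟪b, (u : EuclideanSpace ℝ (Fin (m+1)))⟫ ≤ (1 - l) * 1 :=
          mul_le_mul_of_nonneg_left e2 (by linarith)
        have e5 : l * (κ⁻¹ * ⟪k, (u : EuclideanSpace ℝ (Fin (m+1)))⟫) ≤ l * (κ⁻¹ * suppFn K u) := by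
          gcongr
        have e6 : 0 < l * η := by positivity
        simp only [hg]
        linarith)
      have h3 := h1.trans h2
      rw [← ofReal_integral_eq_lintegral_ofReal (intg _ (by fun_prop))
        (Filter.Eventually.of_forall fun u => by have := hpos u; simp only [Pi.zero_apply]; positivity),
        hTV, ENNReal.ofReal_le_ofReal_iff (integral_nonneg fun u => by
          have := hpos u; simp only [Pi.zero_apply]; positivity), integral_div,
        div_le_div_iff_of_pos_right hn] at h3
      have h4 : ∫ u, (1 + l * g u) ^ (m+1) ∂τ ≤
          ∫ u, (1 + (((m:ℝ)+1) * l) * g u + C * l ^ 2 * G ^ 2) ∂τ := by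
        apply integral_mono (intg _ (by fun_prop)) (intg _ (by fun_prop))
        intro u
        refine (hC (l * g u) (hlg u).le).trans ?_
        have : g u ^ 2 ≤ G ^ 2 := sq_le_sq.2 (hG' u)
        have : C * l ^ 2 * g u ^ 2 ≤ C * l ^ 2 * G ^ 2 := by gcongr
        push_cast
        nlinarith
      have h5 : ∫ u, (1 + (((m:ℝ)+1) * l) * g u + C * l ^ 2 * G ^ 2) ∂τ =
          T + (((m:ℝ)+1) * l) * ∫ u, g u ∂τ + C * l ^ 2 * G ^ 2 * T := by
        rw [integral_add (intg _ (by fun_prop)) (intg _ (by fun_prop)),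
          integral_add (intg _ (by fun_prop)) (intg _ (by fun_prop)), integral_const_mul]
        simp [hT]
        ring
      have h6 : 0 ≤ l * ((m+1) * ∫ u, g u ∂τ + l * (C * G ^ 2 * T)) := by
        have := h3.trans (h4.trans_eq h5)
        nlinarith
      exact nonneg_of_mul_nonneg_right h6 hl
    have lim : Filter.Tendsto (fun l : ℝ => (m+1) * ∫ u, g u ∂τ + l * (C * G ^ 2 * T))
        (nhdsWithin 0 (Set.Ioi 0)) (nhds ((m+1) * ∫ u, g u ∂τ + 0 * (C * G ^ 2 * T))) := by
      apply Filter.Tendsto.mono_left _ nhdsWithin_le_nhds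
      apply Continuous.tendsto
      fun_prop
    have hge := ge_of_tendsto (b := 0) lim (by
      have hmin : (0:ℝ) < min 1 (1 / (|G| + 1)) := by positivity
      filter_upwards [Ioo_mem_nhdsGT hmin] with l hl
      have hl2 := lt_min_iff.1 hl.2
      exact step l hl.1 hl2.1 ((lt_div_iff₀ (by positivity)).1 hl2.2))
    rw [zero_mul, add_zero] at hge
    exact nonneg_of_mul_nonneg_right hge hn
  have key2 : ∀ η > 0, 0 ≤ κ⁻¹ * ∫ u, suppFn K u ∂τ - T + η * T := by
    intro η hη
    have := key η hη
    rw [integral_add (intg _ (by fun_prop)) (intg _ (by fun_prop)),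
          integral_sub (intg _ (by fun_prop)) (intg _ (by fun_prop)), integral_const_mul] at this
    simp only [integral_const, smul_eq_mul] at this
    linarith
  have : 0 ≤ κ⁻¹ * ∫ u, suppFn K u ∂τ - T := by
    by_contra hcon
    push Not at hcon
    have := key2 (-(κ⁻¹ * ∫ u, suppFn K u ∂τ - T) / (2 * (T + 1))) (by
      apply div_pos <;> linarith)
    set q := κ⁻¹ * ∫ u, suppFn K u ∂τ - T
    have h2 : -q / (2 * (T + 1)) * T ≤ -q / 2 := by
      rw [div_mul_eq_mul_div, div_le_div_iff₀ (by positivity) (by positivity)]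
      nlinarith
    linarith
  have h7 : κ * T ≤ κ * (κ⁻¹ * ∫ u, suppFn K u ∂τ) := by gcongr; linarith
  rwa [← mul_assoc, mul_inv_cancel₀ hκ.ne', one_mul] at h7

/-- Urysohn's inequality: for a convex body `K` in `ℝⁿ`, `vol K ≤ M(K)ⁿ · vol B`, where `M(K)`
is the mean value of the support function of `K` over the unit sphere (with respect to the
`(n-1)`-dimensional Hausdorff measure) and `B` is the closed unit ball. Consequently, among
convex bodies of fixed integral breadth the ball has the greatest volume. -/
theorem urysohn_inequality (n : ℕ) (hn : 1 ≤ n)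
    (K : Set (EuclideanSpace ℝ (Fin n)))
    (hKcp : IsCompact K) (hKcv : Convex ℝ K) (hKint : (interior K).Nonempty) :
    volume K ≤
      ENNReal.ofReal
        (((∫ u in Metric.sphere (0 : EuclideanSpace ℝ (Fin n)) 1, suppFn K u ∂μH[(n : ℝ) - 1]) /
          (μH[(n : ℝ) - 1] (Metric.sphere (0 : EuclideanSpace ℝ (Fin n)) 1)).toReal) ^ n) *
      volume (Metric.closedBall (0 : EuclideanSpace ℝ (Fin n)) 1) := by
  obtain ⟨m, rfl⟩ : ∃ m, n = m + 1 := ⟨n - 1, by omega⟩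
  have hd : ((m + 1 : ℕ) : ℝ) - 1 = m := by push_cast; ring
  rw [hd]
  have hne : K.Nonempty := hKint.mono interior_subset
  set S := Metric.sphere (0 : EuclideanSpace ℝ (Fin (m+1))) 1 with hS
  have hSm : MeasurableSet S := Metric.isClosed_sphere.measurableSet
  have hv0 : 0 < volume K := Measure.measure_pos_of_nonempty_interior _ hKint
  have hvt : volume K ≠ ⊤ := hKcp.measure_lt_top.ne
  set B := Metric.closedBall (0 : EuclideanSpace ℝ (Fin (m+1))) 1 with hB
  have hB0 : 0 < volume B := Metric.measure_closedBall_pos _ _ one_pos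
  have hBt : volume B ≠ ⊤ := measure_closedBall_lt_top.ne
  set q := (volume K).toReal / (volume B).toReal with hq
  have hq0 : 0 < q := div_pos (ENNReal.toReal_pos hv0.ne' hvt) (ENNReal.toReal_pos hB0.ne' hBt)
  set κ := q ^ (((m + 1 : ℕ) : ℝ)⁻¹) with hκ
  have hκ0 : 0 < κ := Real.rpow_pos_of_pos hq0 _
  have hκn : κ ^ (m+1) = q := Real.rpow_inv_natCast_pow hq0.le (by omega)
  have hvol : volume K = ENNReal.ofReal (κ ^ (m+1)) * volume B := by
    rw [hκn, hq, ENNReal.ofReal_div_of_pos (ENNReal.toReal_pos hB0.ne' hBt), ENNReal.ofReal_toReal hvt,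
      ENNReal.ofReal_toReal hBt, ENNReal.div_mul_cancel hB0.ne' hBt]
  have main := toSphere_ineq m K hKcp hne κ hκ0 hvol
  set τ := (volume : Measure (EuclideanSpace ℝ (Fin (m+1)))).toSphere with hτ
  let μ1 : Measure S := (μH[(m : ℝ)] : Measure (EuclideanSpace ℝ (Fin (m+1)))).comap Subtype.val
  have hμu : μ1 Set.univ = μH[(m : ℝ)] S := by
    rw [(MeasurableEmbedding.subtype_coe hSm).comap_apply]
    simp
  have : IsFiniteMeasure μ1 := ⟨by rw [hμu]; exact haus_fin m⟩
  have hsc : Continuous fun u : S => suppFn K u :=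
    (suppFn_cont hKcp hne).comp continuous_subtype_val
  have uniq := unif_dist μ1 τ (haus_ball (m : ℝ)) toSphere_ball
    (fun x r hr => Metric.measure_ball_pos _ _ hr) hsc
  have hI : ∫ u, suppFn K u ∂μ1 = ∫ u in S, suppFn K u ∂μH[(m : ℝ)] :=
    integral_subtype_comap hSm (suppFn K)
  have hμr : μ1.real Set.univ = (μH[(m : ℝ)] S).toReal := by rw [measureReal_def, hμu]
  rw [hI, hμr] at uniq
  have hP : 0 < (μH[(m : ℝ)] S).toReal := ENNReal.toReal_pos (haus_pos m).ne' (haus_fin m).ne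
  have hT : 0 < τ.real Set.univ := by
    refine ENNReal.toReal_pos ?_ (measure_ne_top _ _)
    rw [Measure.measure_univ_ne_zero]
    exact Measure.toSphere_ne_zero _
  have hM : κ ≤ (∫ u in S, suppFn K u ∂μH[(m : ℝ)]) / (μH[(m : ℝ)] S).toReal := by
    rw [le_div_iff₀ hP]
    have : (κ * (μH[(m : ℝ)] S).toReal) * τ.real Set.univ ≤
        (∫ u in S, suppFn K u ∂μH[(m : ℝ)]) * τ.real Set.univ := by
      rw [mul_comm (∫ u in S, suppFn K u ∂μH[(m : ℝ)]), ← uniq]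
      nlinarith
    exact le_of_mul_le_mul_right this hT
  rw [hvol]
  gcongr
end

section
/- (Equality case in Urysohn's inequality) Let K be a convex body in ℝ^n and M(K) := (∫_{S^{n-1}} h_K dσ) / σ(S^{n-1}). If vol(K) = M(K)^n · vol(B), where B is the closed unit ball of ℝ^n, then K is a closed Euclidean ball: there exist c ∈ ℝ^n and r > 0 with K equal to the closed ball of center c and radius r. -/
open MeasureTheory RealInnerProductSpace

lemma symm_of_mid {F : Type*} [NormedAddCommGroup F] [NormedSpace ℝ F] (K : Set (F × ℝ))
    (hc : IsCompact K) (hcv : Convex ℝ K) (hne : K.Nonempty)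
    (H : ∀ p ∈ K, ∀ q ∈ K, ∃ s1 s2 : ℝ, ((1/2 : ℝ) • (p.1 + q.1), s1) ∈ K ∧
      ((1/2 : ℝ) • (p.1 + q.1), s2) ∈ K ∧ s1 - s2 = p.2 - q.2) :
    ∃ a : ℝ, ∀ y t, (y, t) ∈ K → (y, 2 * a - t) ∈ K := by
  have hfib : ∀ y, IsCompact {t : ℝ | (y, t) ∈ K} := by
    intro y
    have h1 : IsClosed {t : ℝ | (y, t) ∈ K} :=
      hc.isClosed.preimage (by fun_prop : Continuous fun t : ℝ => (y, t))
    refine (hc.image continuous_snd).of_isClosed_subset h1 ?_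
    intro t ht
    exact ⟨(y, t), ht, rfl⟩
  have hex : ∀ y, ∃ g f : ℝ, y ∈ Prod.fst '' K → (y, g) ∈ K ∧ (y, f) ∈ K ∧
      ∀ t, (y, t) ∈ K → f ≤ t ∧ t ≤ g := by
    intro y
    by_cases hy : y ∈ Prod.fst '' K
    · obtain ⟨⟨y', t⟩, hp, rfl⟩ := hy
      have hn : {s : ℝ | (y', s) ∈ K}.Nonempty := ⟨t, hp⟩
      obtain ⟨g, hg, hg'⟩ := (hfib y').exists_isGreatest hn
      obtain ⟨f, hf, hf'⟩ := (hfib y').exists_isLeast hn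
      exact ⟨g, f, fun _ => ⟨hg, hf, fun s hs => ⟨hf' hs, hg' hs⟩⟩⟩
    · exact ⟨0, 0, fun h => absurd h hy⟩
  choose g f hgf using hex
  have hD : Convex ℝ (Prod.fst '' K) := hcv.linear_image (LinearMap.fst ℝ F ℝ)
  have key : ∀ y1 ∈ Prod.fst '' K, ∀ y2 ∈ Prod.fst '' K,
      g y1 - f y2 ≤ g ((1/2 : ℝ) • (y1 + y2)) - f ((1/2 : ℝ) • (y1 + y2)) := by
    intro y1 h1 y2 h2
    obtain ⟨s1, s2, hs1, hs2, hs⟩ := H _ (hgf y1 h1).1 _ (hgf y2 h2).2.1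
    simp only at hs1 hs2 hs
    have hm : (1/2 : ℝ) • (y1 + y2) ∈ Prod.fst '' K := ⟨_, hs1, rfl⟩
    have := ((hgf _ hm).2.2 _ hs1).2
    have := ((hgf _ hm).2.2 _ hs2).1
    linarith
  have claim : ∀ y1 ∈ Prod.fst '' K, ∀ y2 ∈ Prod.fst '' K, g y2 + f y2 ≤ g y1 + f y1 := by
    intro y1 h1 y2 h2
    let z : ℕ → ℕ → F := fun k i => y1 + ((i : ℝ) / (k + 1)) • (y2 - y1)
    have hz : ∀ k i, i ≤ k + 1 → z k i ∈ Prod.fst '' K := by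
      intro k i hi
      have hk : (0 : ℝ) < k + 1 := by positivity
      refine hD.add_smul_sub_mem h1 h2 ⟨by positivity, ?_⟩
      rw [div_le_one hk]; exact_mod_cast hi
    have hind : ∀ k i, i ≤ k → g (z k (i + 1)) + f (z k i) ≤ g (z k 1) + f (z k 0) := by
      intro k i
      induction i with
      | zero => intro _; simp
      | succ i ih =>
        intro hi
        have e : (1/2 : ℝ) • (z k (i + 1 + 1) + z k i) = z k (i + 1) := by
          simp only [z]
          push_cast
          module
        have := key _ (hz k (i + 1 + 1) (by omega)) _ (hz k i (by omega))
        rw [e] at this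
        have := ih (by omega)
        linarith
    have hfin : ∀ k, g y2 + f (z k k) ≤ g (z k 1) + f y1 := by
      intro k
      have hk : ((k : ℝ) + 1) ≠ 0 := by positivity
      have := hind k k le_rfl
      have e1 : z k (k + 1) = y2 := by
        simp only [z]; push_cast; rw [div_self hk]; module
      have e0 : z k 0 = y1 := by simp [z]
      rwa [e1, e0] at this
    have hseq : ∀ k, ((z k 1, g (z k 1)), (z k k, f (z k k))) ∈ K ×ˢ K := fun k =>
      ⟨(hgf _ (hz k 1 (by omega))).1, (hgf _ (hz k k (by omega))).2.1⟩
    obtain ⟨⟨⟨a, τ⟩, ⟨b, τ'⟩⟩, hab, φ, hφ, hlim⟩ := (hc.prod hc).tendsto_subseq hseq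
    have l0 : Filter.Tendsto (fun k : ℕ => (1 : ℝ) / (k + 1)) Filter.atTop (nhds 0) :=
      tendsto_one_div_add_atTop_nhds_zero_nat
    have l1 : Filter.Tendsto (fun k => z k 1) Filter.atTop (nhds y1) := by
      have : Filter.Tendsto (fun k : ℕ => y1 + ((1 : ℝ) / (k + 1)) • (y2 - y1)) Filter.atTop
        (nhds (y1 + (0 : ℝ) • (y2 - y1))) := tendsto_const_nhds.add (l0.smul_const _)
      simpa [z] using this
    have l2 : Filter.Tendsto (fun k => z k k) Filter.atTop (nhds y2) := by
      have : Filter.Tendsto (fun k : ℕ => y2 - ((1 : ℝ) / (k + 1)) • (y2 - y1)) Filter.atTop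
        (nhds (y2 - (0 : ℝ) • (y2 - y1))) := tendsto_const_nhds.sub (l0.smul_const _)
      rw [zero_smul, sub_zero] at this
      refine this.congr fun k => ?_
      have hk : ((k : ℝ) + 1) ≠ 0 := by positivity
      have : (k : ℝ) / (k + 1) = 1 - 1 / (k + 1) := by field_simp; ring
      simp only [z, this]
      module
    have hl1 := (continuous_fst.tendsto _).comp hlim
    have hl2 := (continuous_snd.tendsto _).comp hlim
    have ha : a = y1 := tendsto_nhds_unique ((continuous_fst.tendsto _).comp hl1)
      (l1.comp hφ.tendsto_atTop)
    have hb : b = y2 := tendsto_nhds_unique ((continuous_fst.tendsto _).comp hl2)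
      (l2.comp hφ.tendsto_atTop)
    subst ha hb
    have t1 := (continuous_snd.tendsto _).comp hl1
    have t2 := (continuous_snd.tendsto _).comp hl2
    have hle : g b + τ' ≤ τ + f a :=
      le_of_tendsto_of_tendsto (tendsto_const_nhds.add t2) (t1.add tendsto_const_nhds)
        (Filter.Eventually.of_forall fun k => hfin (φ k))
    have := ((hgf a h1).2.2 τ hab.1).2
    have := ((hgf b h2).2.2 τ' hab.2).1
    linarith
  obtain ⟨⟨y0, t0⟩, h0⟩ := hne
  have h0' : y0 ∈ Prod.fst '' K := ⟨_, h0, rfl⟩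
  refine ⟨(g y0 + f y0) / 2, fun y t hyt => ?_⟩
  have hy : y ∈ Prod.fst '' K := ⟨_, hyt, rfl⟩
  have e : g y0 + f y0 = g y + f y := le_antisymm (claim _ hy _ h0') (claim _ h0' _ hy)
  obtain ⟨hg, hf, hb⟩ := hgf y hy
  have hconv : Convex ℝ {t : ℝ | (y, t) ∈ K} := by
    intro s hs t ht α β hα hβ hab
    have := hcv hs ht hα hβ hab
    simp only [Prod.smul_mk, Prod.mk_add_mk, ← add_smul, hab, one_smul] at this
    exact this
  have := hb t hyt
  exact hconv.ordConnected.out hf hg ⟨by rw [← mul_div_assoc]; linarith, by linarith⟩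

lemma steiner_vol {F : Type*} [NormedAddCommGroup F] [NormedSpace ℝ F] [FiniteDimensional ℝ F]
    [MeasurableSpace F] [BorelSpace F] (ν : Measure F) [SFinite ν] (K : Set (F × ℝ))
    (hc : IsCompact K) (hcv : Convex ℝ K) :
    ∃ S : Set (F × ℝ), IsCompact S ∧ (ν.prod volume) S = (ν.prod volume) K ∧
      ∀ y t, (y, t) ∈ S ↔ ∃ s1 s2, (y, s1) ∈ K ∧ (y, s2) ∈ K ∧ t = (s1 - s2) / 2 := by
  have hconv : ∀ y, Convex ℝ {t : ℝ | (y, t) ∈ K} := by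
    intro y s hs t ht α β hα hβ hab
    have := hcv hs ht hα hβ hab
    simp only [Prod.smul_mk, Prod.mk_add_mk, ← add_smul, hab, one_smul] at this
    exact this
  have hfib : ∀ y, IsCompact {t : ℝ | (y, t) ∈ K} := by
    intro y
    have h1 : IsClosed {t : ℝ | (y, t) ∈ K} :=
      hc.isClosed.preimage (by fun_prop : Continuous fun t : ℝ => (y, t))
    refine (hc.image continuous_snd).of_isClosed_subset h1 ?_
    intro t ht
    exact ⟨(y, t), ht, rfl⟩
  let T : Set ((F × ℝ) × ℝ) := {p | p.1 ∈ K ∧ (p.1.1, p.2) ∈ K}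
  have hT : IsCompact T := by
    refine (hc.prod (hc.image continuous_snd)).of_isClosed_subset ?_ ?_
    · exact (hc.isClosed.preimage continuous_fst).inter
        (hc.isClosed.preimage (by fun_prop : Continuous fun p : (F × ℝ) × ℝ => (p.1.1, p.2)))
    · intro p hp
      exact ⟨hp.1, ⟨_, hp.2, rfl⟩⟩
  let S := (fun p : (F × ℝ) × ℝ => (p.1.1, (p.1.2 - p.2) / 2)) '' T
  have hS : IsCompact S := hT.image (by fun_prop)
  have hmem : ∀ y t, (y, t) ∈ S ↔ ∃ s1 s2, (y, s1) ∈ K ∧ (y, s2) ∈ K ∧ t = (s1 - s2) / 2 := by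
    intro y t
    constructor
    · rintro ⟨⟨⟨y', s1⟩, s2⟩, ⟨h1, h2⟩, he⟩
      simp only [Prod.mk.injEq] at he
      obtain ⟨rfl, rfl⟩ := he
      exact ⟨s1, s2, h1, h2, rfl⟩
    · rintro ⟨s1, s2, h1, h2, rfl⟩
      exact ⟨((y, s1), s2), ⟨h1, h2⟩, rfl⟩
  refine ⟨S, hS, ?_, hmem⟩
  rw [Measure.prod_apply hS.measurableSet, Measure.prod_apply hc.measurableSet]
  congr 1
  funext y
  rcases Set.eq_empty_or_nonempty {t : ℝ | (y, t) ∈ K} with he | hn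
  · have e1 : Prod.mk y ⁻¹' K = ∅ := he
    have e2 : Prod.mk y ⁻¹' S = ∅ := by
      ext t
      simp only [Set.mem_preimage, hmem, Set.mem_empty_iff_false, iff_false]
      rintro ⟨s1, s2, h1, -⟩
      have : s1 ∈ {t : ℝ | (y, t) ∈ K} := h1
      simp [he] at this
    rw [e1, e2]
  · obtain ⟨g, hg, hg'⟩ := (hfib y).exists_isGreatest hn
    obtain ⟨f, hf, hf'⟩ := (hfib y).exists_isLeast hn
    have e1 : Prod.mk y ⁻¹' K = Set.Icc f g := by
      ext t
      exact ⟨fun h => ⟨hf' h, hg' h⟩, fun h => (hconv y).ordConnected.out hf hg h⟩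
    have e2 : Prod.mk y ⁻¹' S = Set.Icc (-((g - f) / 2)) ((g - f) / 2) := by
      ext t
      simp only [Set.mem_preimage, hmem]
      constructor
      · rintro ⟨s1, s2, h1, h2, rfl⟩
        have := hf' h1
        have := hf' h2
        have := hg' h1
        have := hg' h2
        constructor <;> linarith
      · rintro ⟨h1, h2⟩
        have hk : ∀ s, f ≤ s → s ≤ g → (y, s) ∈ K := fun s a b =>
          (hconv y).ordConnected.out hf hg ⟨a, b⟩
        refine ⟨(f + g) / 2 + t, (f + g) / 2 - t, hk _ ?_ ?_, hk _ ?_ ?_, ?_⟩ <;> linarith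
    rw [e1, e2, Real.volume_Icc, Real.volume_Icc]
    congr 1
    ring

lemma prod_symm {F : Type*} [NormedAddCommGroup F] [NormedSpace ℝ F] [FiniteDimensional ℝ F]
    [MeasurableSpace F] [BorelSpace F] (ν : Measure F) [ν.IsAddHaarMeasure] (K L : Set (F × ℝ))
    (hc : IsCompact K) (hcv : Convex ℝ K) (hi : (interior K).Nonempty)
    (hL : ∀ y t, (y, t) ∈ L ↔ ∃ p ∈ K, ∃ q ∈ K, y = (1/2 : ℝ) • (p.1 + q.1) ∧
      t = (p.2 - q.2) / 2)
    (hLcv : Convex ℝ L) (hv : (ν.prod volume) L ≤ (ν.prod volume) K) :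
    ∃ a : ℝ, ∀ y t, (y, t) ∈ K → (y, 2 * a - t) ∈ K := by
  obtain ⟨S, hSc, hSv, hS⟩ := steiner_vol ν K hc hcv
  have hSL : S ⊆ L := by
    rintro ⟨y, t⟩ h
    obtain ⟨s1, s2, h1, h2, rfl⟩ := (hS y t).1 h
    refine (hL _ _).2 ⟨_, h1, _, h2, ?_, rfl⟩
    simp only
    module
  have hKpos : 0 < (ν.prod volume) K :=
    (isOpen_interior.measure_pos _ hi).trans_le (measure_mono interior_subset)
  have hLi : (interior L).Nonempty := by
    rw [Set.nonempty_iff_ne_empty]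
    intro h0
    have h1 : (ν.prod volume) (frontier L) = 0 := hLcv.addHaar_frontier _
    have h2 : L ⊆ frontier L := by
      rw [frontier, h0, Set.sdiff_empty]; exact subset_closure
    have h3 := measure_mono (μ := ν.prod volume) (hSL.trans h2)
    rw [h1, hSv] at h3
    exact absurd h3 (not_le.2 hKpos)
  have hLS : L ⊆ S := by
    intro x hx
    by_contra hxS
    have hx' : x ∈ closure (interior L) := by
      rw [hLcv.closure_interior_eq_closure_of_nonempty_interior hLi]; exact subset_closure hx
    obtain ⟨w, hw1, hw2⟩ := mem_closure_iff.1 hx' Sᶜ hSc.isClosed.isOpen_compl hxS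
    have hop : IsOpen (Sᶜ ∩ interior L) := hSc.isClosed.isOpen_compl.inter isOpen_interior
    have hpos : 0 < (ν.prod volume) (Sᶜ ∩ interior L) := hop.measure_pos _ ⟨w, hw1, hw2⟩
    have hd : Disjoint S (Sᶜ ∩ interior L) :=
      Set.disjoint_left.2 fun a ha hb => hb.1 ha
    have hu := measure_union (μ := ν.prod volume) hd hop.measurableSet
    have hle : (ν.prod volume) (S ∪ (Sᶜ ∩ interior L)) ≤ (ν.prod volume) K :=
      (measure_mono (Set.union_subset hSL (Set.inter_subset_right.trans interior_subset))).trans hv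
    rw [hu, hSv] at hle
    have hfin : (ν.prod volume) K ≠ ⊤ := hc.measure_lt_top.ne
    exact absurd hle (not_le.2 (ENNReal.lt_add_right hfin hpos.ne'))
  refine symm_of_mid K hc hcv (hi.mono interior_subset) ?_
  intro p hp q hq
  obtain ⟨s1, s2, h1, h2, h⟩ := (hS _ _).1 (hLS ((hL _ _).2 ⟨p, hp, q, hq, rfl, rfl⟩))
  exact ⟨s1, s2, h1, h2, by linarith⟩

/-- The average of `K` and its image under `R`. -/
def symAvg {E : Type*} [NormedAddCommGroup E] [InnerProductSpace ℝ E] (R : E ≃ₗᵢ[ℝ] E)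
    (K : Set E) : Set E := (fun p : E × E => (1/2 : ℝ) • (p.1 + R p.2)) '' (K ×ˢ K)

/-- Decomposition of `E` along a unit vector. -/
noncomputable def splitEquiv {E : Type*} [NormedAddCommGroup E] [InnerProductSpace ℝ E] (u : E)
    (hu : ‖u‖ = 1) : ((ℝ ∙ u)ᗮ × ℝ) ≃ₗ[ℝ] E where
  toFun p := (p.1 : E) + p.2 • u
  map_add' p q := by
    simp only [Prod.fst_add, Prod.snd_add, Submodule.coe_add]; module
  map_smul' c p := by
    simp only [Prod.smul_fst, Prod.smul_snd, Submodule.coe_smul, smul_eq_mul, RingHom.id_apply]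
    module
  invFun x := (⟨x - ⟪u, x⟫ • u, by
    rw [Submodule.mem_orthogonal_singleton_iff_inner_right, inner_sub_right, inner_smul_right,
      real_inner_self_eq_norm_sq, hu]; ring⟩, ⟪u, x⟫)
  left_inv p := by
    have h : ⟪u, (p.1 : E)⟫ = 0 := Submodule.mem_orthogonal_singleton_iff_inner_right.1 p.1.2
    have h2 : ⟪u, (p.1 : E) + p.2 • u⟫ = p.2 := by
      rw [inner_add_right, inner_smul_right, real_inner_self_eq_norm_sq, hu, h]; ring
    refine Prod.ext (Subtype.ext ?_) h2
    simp only [h2]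
    abel
  right_inv x := by simp

lemma symAvg_convex {E : Type*} [NormedAddCommGroup E] [InnerProductSpace ℝ E] (R : E ≃ₗᵢ[ℝ] E)
    (K : Set E) (hK : Convex ℝ K) : Convex ℝ (symAvg R K) := by
  have : IsLinearMap ℝ (fun p : E × E => (1/2 : ℝ) • (p.1 + R p.2)) := by
    constructor
    · intro x y
      simp only [Prod.fst_add, Prod.snd_add, map_add]; module
    · intro c x
      simp only [Prod.smul_fst, Prod.smul_snd, map_smul]; module
  exact (hK.prod hK).is_linear_image this

lemma symAvg_compact {E : Type*} [NormedAddCommGroup E] [InnerProductSpace ℝ E] (R : E ≃ₗᵢ[ℝ] E)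
    (K : Set E) (hK : IsCompact K) : IsCompact (symAvg R K) :=
  (hK.prod hK).image (by fun_prop)

lemma refl_symm {E : Type*} [NormedAddCommGroup E] [InnerProductSpace ℝ E] [FiniteDimensional ℝ E]
    [MeasurableSpace E] [BorelSpace E] (μ : Measure E) [μ.IsAddHaarMeasure] (K : Set E)
    (hc : IsCompact K) (hcv : Convex ℝ K) (hi : (interior K).Nonempty) (u : E) (hu : ‖u‖ = 1)
    (hv : μ (symAvg (ℝ ∙ u)ᗮ.reflection K) ≤ μ K) :
    ∃ a : ℝ, ∀ x ∈ K, x + (2 * (a - ⟪u, x⟫)) • u ∈ K := by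
  let Φ : ((ℝ ∙ u)ᗮ × ℝ) ≃L[ℝ] E := (splitEquiv u hu).toContinuousLinearEquiv
  have hΦ : ∀ y t, Φ (y, t) = (y : E) + t • u := fun y t => rfl
  have hR : ∀ y t, (ℝ ∙ u)ᗮ.reflection (Φ (y, t)) = Φ (y, -t) := by
    intro y t
    rw [hΦ, hΦ, map_add, map_smul, Submodule.reflection_mem_subspace_eq_self y.2,
      Submodule.reflection_orthogonalComplement_singleton_eq_neg]
    module
  let ν : Measure ((ℝ ∙ u)ᗮ : Submodule ℝ E) := Measure.addHaar
  have hm : (μ.map Φ.symm).IsAddHaarMeasure := Φ.symm.isAddHaarMeasure_map μ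
  have hsm := Measure.isAddLeftInvariant_eq_smul (ν.prod (volume : Measure ℝ)) (μ.map Φ.symm)
  have hval : ∀ A : Set E, MeasurableSet A → (ν.prod (volume : Measure ℝ)) (Φ ⁻¹' A) =
      ((ν.prod (volume : Measure ℝ)).addHaarScalarFactor (μ.map Φ.symm)) * μ A := by
    intro A hA
    have hA' : MeasurableSet (Φ ⁻¹' A) := hA.preimage Φ.continuous.measurable
    have e : Φ.symm ⁻¹' (Φ ⁻¹' A) = A := by
      ext x; simp
    conv_lhs => rw [hsm]
    rw [Measure.smul_apply, Measure.map_apply Φ.symm.continuous.measurable hA', e]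
    rfl
  have hmem : ∀ y t, (y, t) ∈ Φ ⁻¹' (symAvg (ℝ ∙ u)ᗮ.reflection K) ↔
      ∃ p ∈ Φ ⁻¹' K, ∃ q ∈ Φ ⁻¹' K, y = (1/2 : ℝ) • (p.1 + q.1) ∧ t = (p.2 - q.2) / 2 := by
    intro y t
    constructor
    · rintro ⟨⟨p, q⟩, ⟨hp, hq⟩, he⟩
      obtain ⟨⟨y1, t1⟩, rfl⟩ := Φ.surjective p
      obtain ⟨⟨y2, t2⟩, rfl⟩ := Φ.surjective q
      refine ⟨(y1, t1), hp, (y2, t2), hq, ?_⟩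
      simp only [hR] at he
      rw [← map_add, ← map_smul] at he
      have := Φ.injective he
      simp only [Prod.mk_add_mk, Prod.smul_mk, Prod.mk.injEq, smul_eq_mul] at this
      refine ⟨this.1.symm, ?_⟩
      rw [← this.2]; ring
    · rintro ⟨⟨y1, t1⟩, hp, ⟨y2, t2⟩, hq, rfl, rfl⟩
      refine ⟨(Φ (y1, t1), Φ (y2, t2)), ⟨hp, hq⟩, ?_⟩
      simp only [hR]
      rw [← map_add, ← map_smul]
      congr 1
      simp only [Prod.mk_add_mk, Prod.smul_mk, Prod.mk.injEq, smul_eq_mul, true_and]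
      ring
  have hvol : (ν.prod (volume : Measure ℝ)) (Φ ⁻¹' (symAvg (ℝ ∙ u)ᗮ.reflection K)) ≤
      (ν.prod (volume : Measure ℝ)) (Φ ⁻¹' K) := by
    rw [hval _ (symAvg_compact _ K hc).measurableSet, hval _ hc.measurableSet]
    gcongr
  obtain ⟨a, ha⟩ := prod_symm ν (Φ ⁻¹' K) (Φ ⁻¹' (symAvg (ℝ ∙ u)ᗮ.reflection K))
    (Φ.toHomeomorph.isCompact_preimage.2 hc) (hcv.linear_preimage Φ.toLinearEquiv.toLinearMap)
    (by
      rw [show interior (Φ ⁻¹' K) = Φ ⁻¹' (interior K) from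
        (Φ.toHomeomorph.preimage_interior K).symm]
      exact hi.preimage Φ.surjective) hmem
    ((symAvg_convex (ℝ ∙ u)ᗮ.reflection K hcv).linear_preimage Φ.toLinearEquiv.toLinearMap) hvol
  refine ⟨a, fun x hx => ?_⟩
  obtain ⟨⟨y, t⟩, rfl⟩ := Φ.surjective x
  have := ha y t hx
  have e : Φ (y, t) + (2 * (a - ⟪u, Φ (y, t)⟫)) • u = Φ (y, 2 * a - t) := by
    have h : ⟪u, (y : E)⟫ = 0 := Submodule.mem_orthogonal_singleton_iff_inner_right.1 y.2
    rw [hΦ, hΦ, inner_add_right, inner_smul_right, real_inner_self_eq_norm_sq, hu, h]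
    module
  rw [e]; exact this

lemma ball_of_symm {n : ℕ} (hn : 1 ≤ n) (K : Set (EuclideanSpace ℝ (Fin n)))
    (hc : IsCompact K) (hcv : Convex ℝ K) (hi : (interior K).Nonempty)
    (H : ∀ u : EuclideanSpace ℝ (Fin n), ‖u‖ = 1 →
      ∃ a : ℝ, ∀ x ∈ K, x + (2 * (a - ⟪u, x⟫)) • u ∈ K) :
    ∃ (c : EuclideanSpace ℝ (Fin n)) (r : ℝ), 0 < r ∧ K = Metric.closedBall c r := by
  have : Nonempty (Fin n) := ⟨⟨0, hn⟩⟩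
  have : Nontrivial (EuclideanSpace ℝ (Fin n)) := inferInstance
  have hpos : 0 < volume K :=
    (isOpen_interior.measure_pos _ hi).trans_le (measure_mono interior_subset)
  have hfin : volume K ≠ ⊤ := hc.measure_lt_top.ne
  have hVpos : 0 < (volume K).toReal := ENNReal.toReal_pos hpos.ne' hfin
  set V := (volume K).toReal with hV
  let c : EuclideanSpace ℝ (Fin n) := V⁻¹ • ∫ x in K, x
  have hxint : IntegrableOn (fun x : EuclideanSpace ℝ (Fin n) => x) K :=
    continuous_id.continuousOn.integrableOn_compact hc
  have hcen : ∀ u : EuclideanSpace ℝ (Fin n), ‖u‖ = 1 →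
      ∀ x ∈ K, x + (2 * (⟪u, c⟫ - ⟪u, x⟫)) • u ∈ K := by
    intro u hu
    obtain ⟨a, ha⟩ := H u hu
    let R := (ℝ ∙ u)ᗮ.reflection
    have hRx : ∀ x, R x = x - (2 * ⟪u, x⟫) • u := by
      intro x
      simp only [R]
      rw [Submodule.reflection_orthogonal_apply, Submodule.reflection_singleton_apply]
      simp only [hu, RCLike.ofReal_real_eq_id, id_eq, one_pow, div_one]
      module
    have hmp : MeasurePreserving (fun x : EuclideanSpace ℝ (Fin n) => R x + (2 * a) • u) := 
      (measurePreserving_add_right volume ((2 * a) • u)).comp R.measurePreserving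
    have hform : ∀ x, R x + (2 * a) • u = x + (2 * (a - ⟪u, x⟫)) • u := by
      intro x; rw [hRx]; module
    have hinv : ∀ x, R (R x + (2 * a) • u) + (2 * a) • u = x := by
      intro x
      have h1 : R u = -u := Submodule.reflection_orthogonalComplement_singleton_eq_neg u
      have h2 : R (R x) = x := Submodule.reflection_reflection _ x
      rw [map_add, map_smul, h1, h2]
      module
    have hpre : (fun x : EuclideanSpace ℝ (Fin n) => R x + (2 * a) • u) ⁻¹' K = K := by
      ext x
      constructor
      · intro hx
        have := ha _ hx
        rwa [← hform, hinv] at this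
      · intro hx
        have := ha _ hx
        rwa [← hform] at this
    have hemb : MeasurableEmbedding (fun x : EuclideanSpace ℝ (Fin n) => R x + (2 * a) • u) :=
      (R.toHomeomorph.trans (Homeomorph.addRight ((2 * a) • u))).measurableEmbedding
    have hI := hmp.setIntegral_preimage_emb hemb (fun x => ⟪u, x⟫) K
    rw [hpre] at hI
    have hf : ∀ x, ⟪u, R x + (2 * a) • u⟫ = 2 * a - ⟪u, x⟫ := by
      intro x
      rw [hform, inner_add_right, inner_smul_right, real_inner_self_eq_norm_sq, hu]; ring
    simp only [hf] at hI
    have hxint2 : IntegrableOn (fun x : EuclideanSpace ℝ (Fin n) => ⟪u, x⟫) K :=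
      (by fun_prop : Continuous fun x : EuclideanSpace ℝ (Fin n) => ⟪u, x⟫).continuousOn.integrableOn_compact hc
    rw [integral_sub (integrable_const_iff.2 (Or.inr ⟨by simpa using hfin.lt_top⟩)) hxint2, setIntegral_const] at hI
    have hcu : ⟪u, c⟫ = a := by
      have h3 : ⟪u, ∫ x in K, x⟫ = ∫ x in K, ⟪u, x⟫ := (integral_inner hxint u).symm
      simp only [c, inner_smul_right, h3]
      simp only [Measure.real, ← hV, smul_eq_mul] at hI
      field_simp
      linarith
    rw [hcu]; exact ha
  have hrot : ∀ x ∈ K, ∀ y, ‖y - c‖ = ‖x - c‖ → y ∈ K := by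
    intro x hx y hy
    by_cases hxy : x = y
    · exact hxy ▸ hx
    have hd : 0 < ‖x - y‖ := norm_pos_iff.2 (sub_ne_zero.2 hxy)
    have := hcen (‖x - y‖⁻¹ • (x - y)) (by rw [norm_smul, norm_inv, norm_norm, inv_mul_cancel₀ hd.ne']) x hx
    have e : (2 * (⟪‖x - y‖⁻¹ • (x - y), c⟫ - ⟪‖x - y‖⁻¹ • (x - y), x⟫)) = -‖x - y‖ := by
      have h1 : ‖y - c‖ ^ 2 = ‖(x - c) - (x - y)‖ ^ 2 := by congr 2; abel
      rw [hy, norm_sub_sq_real (x - c), real_inner_comm] at h1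
      rw [real_inner_smul_left, real_inner_smul_left]
      have h2 : ⟪x - y, x - c⟫ = ⟪x - y, x⟫ - ⟪x - y, c⟫ := inner_sub_right _ _ _
      rw [h2] at h1
      field_simp
      linarith
    rw [e, smul_smul, neg_mul, mul_inv_cancel₀ hd.ne'] at this
    simpa using this
  obtain ⟨x0, hx0, hmax⟩ := hc.exists_isMaxOn (hi.mono interior_subset)
    (by fun_prop : Continuous fun x => ‖x - c‖).continuousOn
  have hsub : K ⊆ Metric.closedBall c ‖x0 - c‖ := by
    intro x hx
    rw [mem_closedBall_iff_norm]; exact hmax hx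
  have hr : 0 < ‖x0 - c‖ := by
    rw [norm_pos_iff]
    intro h0
    rw [h0, norm_zero, Metric.closedBall_zero] at hsub
    have := interior_mono hsub
    rw [interior_singleton] at this
    exact hi.ne_empty (Set.subset_empty_iff.1 this)
  refine ⟨c, _, hr, hsub.antisymm ?_⟩
  rw [← convexHull_sphere_eq_closedBall c hr.le]
  refine convexHull_min ?_ hcv
  intro y hy
  exact hrot x0 hx0 y (mem_sphere_iff_norm.1 hy)

section Support

variable {n : ℕ} {K : Set (EuclideanSpace ℝ (Fin n))}

lemma suppFn_le (hne : K.Nonempty) {u : EuclideanSpace ℝ (Fin n)} {b : ℝ}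
    (h : ∀ x ∈ K, ⟪x, u⟫ ≤ b) : suppFn K u ≤ b := by
  refine csSup_le (hne.image _) ?_
  rintro _ ⟨x, hx, rfl⟩
  exact h x hx

lemma le_suppFn (hc : IsCompact K) {x : EuclideanSpace ℝ (Fin n)} (hx : x ∈ K)
    (u : EuclideanSpace ℝ (Fin n)) : ⟪x, u⟫ ≤ suppFn K u :=
  le_csSup (hc.image (by fun_prop)).bddAbove ⟨x, hx, rfl⟩

lemma suppFn_mono_add {L : Set (EuclideanSpace ℝ (Fin n))} (hL : IsCompact L) (hne : K.Nonempty)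
    {u v : EuclideanSpace ℝ (Fin n)} {d : ℝ}
    (h : ∀ x ∈ K, ∃ y ∈ L, ⟪x, u⟫ ≤ ⟪y, v⟫ + d) : suppFn K u ≤ suppFn L v + d := by
  refine suppFn_le hne fun x hx => ?_
  obtain ⟨y, hy, hxy⟩ := h x hx
  have := le_suppFn hL hy v
  linarith

lemma suppFn_abs_le (hc : IsCompact K) (hne : K.Nonempty) {r : ℝ}
    (hr : K ⊆ Metric.closedBall 0 r) (u : EuclideanSpace ℝ (Fin n)) :
    |suppFn K u| ≤ r * ‖u‖ := by
  have hb : ∀ x ∈ K, |⟪x, u⟫| ≤ r * ‖u‖ := fun x hx =>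
    (abs_real_inner_le_norm x u).trans (by
      have := mem_closedBall_zero_iff.1 (hr hx)
      gcongr)
  rw [abs_le]
  constructor
  · obtain ⟨x, hx⟩ := hne
    exact (abs_le.1 (hb x hx)).1.trans (le_suppFn hc hx u)
  · exact suppFn_le hne fun x hx => (abs_le.1 (hb x hx)).2

lemma suppFn_continuous (hc : IsCompact K) (hne : K.Nonempty) : Continuous (suppFn K) := by
  obtain ⟨r, hr⟩ := hc.isBounded.subset_closedBall 0
  have key : ∀ u v, suppFn K u ≤ suppFn K v + r * dist u v := by
    intro u v
    refine suppFn_mono_add hc hne fun x hx => ⟨x, hx, ?_⟩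
    have h1 : ⟪x, u⟫ = ⟪x, v⟫ + ⟪x, u - v⟫ := by rw [inner_sub_right]; ring
    have h2 : ⟪x, u - v⟫ ≤ r * dist u v := by
      rw [dist_eq_norm]
      refine (real_inner_le_norm _ _).trans ?_
      have := mem_closedBall_zero_iff.1 (hr hx)
      gcongr
    linarith
  have hr0 : 0 ≤ r := by
    obtain ⟨x, hx⟩ := hne
    exact (norm_nonneg x).trans (mem_closedBall_zero_iff.1 (hr hx))
  exact (LipschitzWith.of_le_add_mul ⟨r, hr0⟩ key).continuous

lemma suppFn_symAvg (hc : IsCompact K) (hne : K.Nonempty)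
    (R : EuclideanSpace ℝ (Fin n) ≃ₗᵢ[ℝ] EuclideanSpace ℝ (Fin n))
    (u : EuclideanSpace ℝ (Fin n)) :
    suppFn (symAvg R K) u = (suppFn K u + suppFn K (R.symm u)) / 2 := by
  have hin : ∀ p q : EuclideanSpace ℝ (Fin n), ⟪(1/2 : ℝ) • (p + R q), u⟫ =
      (⟪p, u⟫ + ⟪q, R.symm u⟫) / 2 := by
    intro p q
    have : ⟪R q, u⟫ = ⟪q, R.symm u⟫ := by
      rw [← R.inner_map_map q, R.apply_symm_apply]
    rw [real_inner_smul_left, inner_add_left, this]; ring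
  apply le_antisymm
  · refine suppFn_le ((hne.prod hne).image _) ?_
    rintro _ ⟨⟨p, q⟩, ⟨hp, hq⟩, rfl⟩
    simp only [hin]
    have := le_suppFn hc hp u
    have := le_suppFn hc hq (R.symm u)
    linarith
  · have h1 : suppFn K u ≤ 2 * suppFn (symAvg R K) u - suppFn K (R.symm u) := by
      refine suppFn_le hne fun p hp => ?_
      have h2 : suppFn K (R.symm u) ≤ 2 * suppFn (symAvg R K) u - ⟪p, u⟫ := by
        refine suppFn_le hne fun q hq => ?_
        have := le_suppFn (symAvg_compact R K hc) ⟨(p, q), ⟨hp, hq⟩, rfl⟩ u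
        simp only [hin] at this
        linarith
      linarith
    linarith

lemma compact_hull (hc : IsCompact K) : IsCompact (closure (convexHull ℝ K)) :=
  ((isBounded_convexHull (s := K)).2 hc.isBounded).isCompact_closure

lemma suppFn_hull (hc : IsCompact K) (hne : K.Nonempty) (u : EuclideanSpace ℝ (Fin n)) :
    suppFn (closure (convexHull ℝ K)) u = suppFn K u := by
  apply le_antisymm
  · refine suppFn_le hne.convexHull.closure fun x hx => ?_
    have hcv : Convex ℝ {y : EuclideanSpace ℝ (Fin n) | ⟪y, u⟫ ≤ suppFn K u} :=
      convex_halfSpace_le ⟨fun a b => inner_add_left a b u,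
        fun c a => real_inner_smul_left a u c⟩ _
    have hcl : IsClosed {y : EuclideanSpace ℝ (Fin n) | ⟪y, u⟫ ≤ suppFn K u} :=
      isClosed_le (by fun_prop) continuous_const
    exact closure_minimal (convexHull_min (fun y hy => le_suppFn hc hy u) hcv) hcl hx
  · exact suppFn_le hne fun x hx =>
      le_suppFn (compact_hull hc) (subset_closure (subset_convexHull ℝ K hx)) u

lemma suppFn_closedBall (c : EuclideanSpace ℝ (Fin n)) {r : ℝ} (hr : 0 ≤ r)
    (u : EuclideanSpace ℝ (Fin n)) (hu : ‖u‖ = 1) :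
    suppFn (Metric.closedBall c r) u = ⟪c, u⟫ + r := by
  apply le_antisymm
  · refine suppFn_le ⟨c, Metric.mem_closedBall_self hr⟩ fun x hx => ?_
    have h1 : ⟪x, u⟫ = ⟪c, u⟫ + ⟪x - c, u⟫ := by rw [inner_sub_left]; ring
    have h2 := real_inner_le_norm (x - c) u
    rw [hu, mul_one] at h2
    have := mem_closedBall_iff_norm.1 hx
    linarith
  · have hm : c + r • u ∈ Metric.closedBall c r := by
      rw [mem_closedBall_iff_norm, add_sub_cancel_left, norm_smul, hu, Real.norm_of_nonneg hr,
        mul_one]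
    have := le_suppFn (isCompact_closedBall c r) hm u
    rwa [inner_add_left, real_inner_smul_left, real_inner_self_eq_norm_sq, hu, one_pow,
      mul_one] at this

lemma suppFn_dist (A B : TopologicalSpace.NonemptyCompacts (EuclideanSpace ℝ (Fin n)))
    (u : EuclideanSpace ℝ (Fin n)) (hu : ‖u‖ = 1) :
    suppFn (A : Set (EuclideanSpace ℝ (Fin n))) u ≤ suppFn (B : Set _) u + dist A B := by
  refine le_of_forall_pos_le_add fun ε hε => ?_
  rw [add_assoc]
  refine suppFn_mono_add B.isCompact A.nonempty fun x hx => ?_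
  have hlt : Metric.hausdorffDist (A : Set (EuclideanSpace ℝ (Fin n))) B < dist A B + ε := by
    rw [Metric.NonemptyCompacts.dist_eq]; linarith
  obtain ⟨y, hy, hxy⟩ := Metric.exists_dist_lt_of_hausdorffDist_lt hx hlt
    (Metric.hausdorffEDist_ne_top_of_nonempty_of_bounded A.nonempty B.nonempty
      A.isCompact.isBounded B.isCompact.isBounded)
  refine ⟨y, hy, ?_⟩
  have h1 : ⟪x, u⟫ = ⟪y, u⟫ + ⟪x - y, u⟫ := by rw [inner_sub_left]; ring
  have h2 := real_inner_le_norm (x - y) u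
  rw [hu, mul_one, ← dist_eq_norm] at h2
  linarith

lemma vol_usc (s : Set (TopologicalSpace.NonemptyCompacts (EuclideanSpace ℝ (Fin n)))) :
    UpperSemicontinuousOn (fun A : TopologicalSpace.NonemptyCompacts (EuclideanSpace ℝ (Fin n)) =>
      volume (A : Set (EuclideanSpace ℝ (Fin n)))) s := by
  intro A _ y hy
  have ht := tendsto_measure_cthickening_of_isCompact (μ := volume) A.isCompact
  have hev := ht.eventually (gt_mem_nhds hy)
  obtain ⟨δ, hδ, hball⟩ := Metric.eventually_nhds_iff.1 hev
  have hδ2 : volume (Metric.cthickening (δ / 2) (A : Set (EuclideanSpace ℝ (Fin n)))) < y :=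
    hball (by rw [Real.dist_eq, sub_zero, abs_of_pos (by linarith)]; linarith)
  refine Filter.Eventually.filter_mono nhdsWithin_le_nhds ?_
  filter_upwards [Metric.ball_mem_nhds A (half_pos hδ)] with B hB
  refine lt_of_le_of_lt (measure_mono ?_) hδ2
  intro x hx
  rw [Metric.mem_ball, Metric.NonemptyCompacts.dist_eq] at hB
  obtain ⟨z, hz, hxz⟩ := Metric.exists_dist_lt_of_hausdorffDist_lt hx hB
    (Metric.hausdorffEDist_ne_top_of_nonempty_of_bounded B.nonempty A.nonempty
      B.isCompact.isBounded A.isCompact.isBounded)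
  exact Metric.mem_cthickening_of_dist_le x z _ _ hz hxz.le

lemma suppFn_integrable (μ : Measure (EuclideanSpace ℝ (Fin n)))
    (hμ : μ (Metric.sphere 0 1) ≠ ⊤) (hc : IsCompact K) (hne : K.Nonempty) :
    IntegrableOn (suppFn K) (Metric.sphere 0 1) μ := by
  obtain ⟨r, hr⟩ := hc.isBounded.subset_closedBall 0
  refine Measure.integrableOn_of_bounded (M := r) hμ
    (suppFn_continuous hc hne).aestronglyMeasurable ?_
  rw [ae_restrict_iff' Metric.isClosed_sphere.measurableSet]
  refine Filter.Eventually.of_forall fun u hu => ?_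
  have := suppFn_abs_le hc hne hr u
  rwa [mem_sphere_zero_iff_norm.1 hu, mul_one] at this

lemma setIntegral_isometry (d : ℝ) (f : EuclideanSpace ℝ (Fin n) → ℝ)
    (R : EuclideanSpace ℝ (Fin n) ≃ₗᵢ[ℝ] EuclideanSpace ℝ (Fin n)) :
    ∫ u in Metric.sphere 0 1, f (R u) ∂μH[d] = ∫ u in Metric.sphere 0 1, f u ∂μH[d] := by
  have h := (R.toIsometryEquiv.measurePreserving_hausdorffMeasure d).setIntegral_preimage_emb
    R.toHomeomorph.measurableEmbedding f (Metric.sphere 0 1)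
  have hp : R.toIsometryEquiv ⁻¹' (Metric.sphere 0 1) = Metric.sphere 0 1 := by
    ext x; simp
  rw [hp] at h
  exact h

end Support

theorem urysohn_equality_case (n : ℕ) (hn : 1 ≤ n)
    (K : Set (EuclideanSpace ℝ (Fin n)))
    (hKcp : IsCompact K) (hKcv : Convex ℝ K) (hKint : (interior K).Nonempty)
    (heq : volume K =
      ENNReal.ofReal
        (((∫ u in Metric.sphere (0 : EuclideanSpace ℝ (Fin n)) 1, suppFn K u ∂μH[(n : ℝ) - 1]) /
          (μH[(n : ℝ) - 1] (Metric.sphere (0 : EuclideanSpace ℝ (Fin n)) 1)).toReal) ^ n) *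
      volume (Metric.closedBall (0 : EuclideanSpace ℝ (Fin n)) 1)) :
    ∃ (c : EuclideanSpace ℝ (Fin n)) (r : ℝ), 0 < r ∧ K = Metric.closedBall c r := by
  have hpos : 0 < volume K :=
    (isOpen_interior.measure_pos _ hKint).trans_le (measure_mono interior_subset)
  have hKne : K.Nonempty := hKint.mono interior_subset
  set μ : Measure (EuclideanSpace ℝ (Fin n)) := μH[(n : ℝ) - 1] with hμ
  set w := (μ (Metric.sphere (0 : EuclideanSpace ℝ (Fin n)) 1)).toReal with hw
  have hw0 : w ≠ 0 := by
    intro h0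
    rw [h0, div_zero, zero_pow (by omega), ENNReal.ofReal_zero, zero_mul] at heq
    exact hpos.ne' heq
  have hwpos : 0 < w := lt_of_le_of_ne ENNReal.toReal_nonneg hw0.symm
  have hfin : μ (Metric.sphere (0 : EuclideanSpace ℝ (Fin n)) 1) ≠ ⊤ := by
    intro h; rw [hw, h] at hw0; simp at hw0
  let A : Set (EuclideanSpace ℝ (Fin n)) → ℝ := fun L => ∫ u in Metric.sphere 0 1, suppFn L u ∂μ
  have hAK : A K = ∫ u in Metric.sphere 0 1, suppFn K u ∂μ := rfl
  rw [← hAK] at heq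
  have hAavg : ∀ L : Set (EuclideanSpace ℝ (Fin n)), IsCompact L → L.Nonempty →
      ∀ R : EuclideanSpace ℝ (Fin n) ≃ₗᵢ[ℝ] EuclideanSpace ℝ (Fin n), A (symAvg R L) = A L := by
    intro L hL hne R
    have hi := suppFn_integrable μ hfin hL hne
    have hi2 : IntegrableOn (fun u => suppFn L (R.symm u)) (Metric.sphere 0 1) μ := by
      have e : (fun u => suppFn L (R.symm u)) =
          fun u => 2 * suppFn (symAvg R L) u - suppFn L u := by
        funext u; rw [suppFn_symAvg hL hne]; ring
      rw [e]
      exact ((suppFn_integrable μ hfin (symAvg_compact R L hL)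
        ((hne.prod hne).image _)).const_mul 2).sub hi
    simp only [A, suppFn_symAvg hL hne]
    rw [integral_div, integral_add hi hi2, setIntegral_isometry _ (suppFn L) R.symm]
    ring
  have hAball : ∀ (c : EuclideanSpace ℝ (Fin n)) (r : ℝ), 0 < r →
      A (Metric.closedBall c r) = r * w := by
    intro c r hr
    have e1 : A (Metric.closedBall c r) = ∫ u in Metric.sphere 0 1, (⟪c, u⟫ + r) ∂μ :=
      setIntegral_congr_fun Metric.isClosed_sphere.measurableSet fun u hu =>
        suppFn_closedBall c hr.le u (mem_sphere_zero_iff_norm.1 hu)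
    have hic : IntegrableOn (fun _ : EuclideanSpace ℝ (Fin n) => r) (Metric.sphere 0 1) μ :=
      integrableOn_const hfin
    have hii : IntegrableOn (fun u : EuclideanSpace ℝ (Fin n) => ⟪c, u⟫) (Metric.sphere 0 1) μ := by
      refine Measure.integrableOn_of_bounded (M := ‖c‖) hfin
        (by fun_prop : Continuous fun u : EuclideanSpace ℝ (Fin n) => ⟪c, u⟫).aestronglyMeasurable
        ?_
      rw [ae_restrict_iff' Metric.isClosed_sphere.measurableSet]
      refine Filter.Eventually.of_forall fun u hu => ?_
      have := norm_inner_le_norm (𝕜 := ℝ) c u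
      rwa [mem_sphere_zero_iff_norm.1 hu, mul_one] at this
    have hz : ∫ u in Metric.sphere 0 1, ⟪c, u⟫ ∂μ = 0 := by
      have := setIntegral_isometry ((n : ℝ) - 1) (fun u => ⟪c, u⟫) (LinearIsometryEquiv.neg ℝ)
      simp only [LinearIsometryEquiv.coe_neg, inner_neg_right, integral_neg] at this
      rw [← hμ] at this
      linarith
    rw [e1, integral_add hii hic, hz, setIntegral_const, Measure.real, ← hw, smul_eq_mul]
    ring
  obtain ⟨ρ, hρ⟩ := hKcp.isBounded.subset_closedBall 0
  let C : Set (TopologicalSpace.NonemptyCompacts (EuclideanSpace ℝ (Fin n))) :=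
    {L | (L : Set (EuclideanSpace ℝ (Fin n))) ⊆ Metric.closedBall 0 ρ} ∩
    {L | A (L : Set (EuclideanSpace ℝ (Fin n))) ≤ A K}
  have hAcont : Continuous
      fun L : TopologicalSpace.NonemptyCompacts (EuclideanSpace ℝ (Fin n)) =>
        A (L : Set (EuclideanSpace ℝ (Fin n))) := by
    have key : ∀ L M : TopologicalSpace.NonemptyCompacts (EuclideanSpace ℝ (Fin n)),
        A (L : Set (EuclideanSpace ℝ (Fin n))) ≤ A (M : Set (EuclideanSpace ℝ (Fin n))) +
          w * dist L M := by
      intro L M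
      have hic : IntegrableOn (fun _ : EuclideanSpace ℝ (Fin n) => dist L M)
        (Metric.sphere 0 1) μ := integrableOn_const hfin
      have hM := suppFn_integrable μ hfin M.isCompact M.nonempty
      have := setIntegral_mono_on (suppFn_integrable μ hfin L.isCompact L.nonempty)
        (hM.add hic) Metric.isClosed_sphere.measurableSet fun u hu =>
          suppFn_dist L M u (mem_sphere_zero_iff_norm.1 hu)
      refine this.trans (le_of_eq ?_)
      simp only [Pi.add_apply]
      rw [integral_add hM hic, setIntegral_const, Measure.real, ← hw, smul_eq_mul]
    exact (LipschitzWith.of_le_add_mul ⟨w, hwpos.le⟩ key).continuous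
  have hCc : IsCompact C :=
    (TopologicalSpace.NonemptyCompacts.isCompact_subsets_of_isCompact
      (isCompact_closedBall 0 ρ)).inter_right (isClosed_le hAcont continuous_const)
  have hKC : (⟨⟨K, hKcp⟩, hKne⟩ : TopologicalSpace.NonemptyCompacts _) ∈ C := ⟨hρ, le_refl (A K)⟩
  obtain ⟨K0, hK0, hmax⟩ := UpperSemicontinuousOn.exists_isMaxOn ⟨_, hKC⟩ hCc (vol_usc C)
  have hmax' : ∀ L : Set (EuclideanSpace ℝ (Fin n)), IsCompact L → L.Nonempty →
      L ⊆ Metric.closedBall 0 ρ → A L ≤ A K →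
      volume L ≤ volume (K0 : Set (EuclideanSpace ℝ (Fin n))) := by
    intro L h1 h2 h3 h4
    exact hmax (show (⟨⟨L, h1⟩, h2⟩ : TopologicalSpace.NonemptyCompacts _) ∈ C from ⟨h3, h4⟩)
  -- a maximizer that is a convex body is a ball
  have main : ∀ L : Set (EuclideanSpace ℝ (Fin n)), IsCompact L → Convex ℝ L →
      (interior L).Nonempty → L ⊆ Metric.closedBall 0 ρ → A L ≤ A K →
      volume (K0 : Set (EuclideanSpace ℝ (Fin n))) ≤ volume L →
      ∃ (c : EuclideanSpace ℝ (Fin n)) (r : ℝ), 0 < r ∧ L = Metric.closedBall c r := by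
    intro L hLc hLcv hLi hLρ hLA hLv
    have hLne : L.Nonempty := hLi.mono interior_subset
    refine ball_of_symm hn L hLc hLcv hLi fun u hu => refl_symm volume L hLc hLcv hLi u hu ?_
    refine (hmax' _ (symAvg_compact _ L hLc) ((hLne.prod hLne).image _) ?_ ?_).trans hLv
    · rintro _ ⟨⟨p, q⟩, ⟨hp, hq⟩, rfl⟩
      have h1 := mem_closedBall_zero_iff.1 (hLρ hp)
      have h2 := mem_closedBall_zero_iff.1 (hLρ hq)
      rw [mem_closedBall_zero_iff, norm_smul]
      have h3 := norm_add_le p ((ℝ ∙ u)ᗮ.reflection q)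
      rw [LinearIsometryEquiv.norm_map] at h3
      norm_num
      linarith
    · rw [hAavg L hLc hLne]; exact hLA
  have hKK0 := hmax' K hKcp hKne hρ le_rfl
  have hK1v : volume (K0 : Set (EuclideanSpace ℝ (Fin n))) ≤
      volume (closure (convexHull ℝ (K0 : Set (EuclideanSpace ℝ (Fin n))))) :=
    measure_mono ((subset_convexHull ℝ _).trans subset_closure)
  have hK1cv : Convex ℝ (closure (convexHull ℝ (K0 : Set (EuclideanSpace ℝ (Fin n))))) :=
    (convex_convexHull ℝ _).closure
  have hK1A : A (closure (convexHull ℝ (K0 : Set (EuclideanSpace ℝ (Fin n))))) ≤ A K := by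
    simp only [A, suppFn_hull K0.isCompact K0.nonempty]
    exact hK0.2
  obtain ⟨c, r, hr, hball⟩ := main (closure (convexHull ℝ (K0 : Set (EuclideanSpace ℝ (Fin n)))))
    (compact_hull K0.isCompact) hK1cv (by
      rw [Set.nonempty_iff_ne_empty]
      intro h0
      have h1 : volume (frontier (closure (convexHull ℝ (K0 : Set (EuclideanSpace ℝ (Fin n)))))) = 0 :=
        hK1cv.addHaar_frontier _
      have h2 : closure (convexHull ℝ (K0 : Set (EuclideanSpace ℝ (Fin n)))) ⊆
          frontier (closure (convexHull ℝ (K0 : Set (EuclideanSpace ℝ (Fin n))))) := by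
        conv_rhs => rw [frontier, h0, Set.sdiff_empty]
        exact subset_closure
      have h3 := (hKK0.trans hK1v).trans (measure_mono h2)
      rw [h1] at h3
      exact absurd h3 (not_le.2 hpos))
    (closure_minimal (convexHull_min hK0.1 (convex_closedBall 0 ρ)) Metric.isClosed_closedBall) hK1A hK1v
  rw [hball, hAball c r hr] at hK1A
  refine main K hKcp hKcv hKint hρ le_rfl (hK1v.trans ?_)
  rw [hball, heq, Measure.addHaar_closedBall' _ _ hr.le, finrank_euclideanSpace_fin]
  gcongr
  rwa [le_div_iff₀ hwpos]
end
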